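/- Let ζ ∈ ∂𝔻. Each wing of ζ contains at most one point that is strongly minimal in ζ: if z, w ∈ I⁺(ζ) are both strongly minimal in ζ, then z = w, and likewise if z, w ∈ I⁻(ζ) are both strongly minimal in ζ, then z = w. -/

import Mathlib

open Filter Topology Metric Set OnePoint

noncomputable section

local notation "ℂ∞" => OnePoint ℂ

/-- A set `K` is locally connected (connected im kleinen) at a point `z`:
every neighborhood of `z` in `K` contains a connected neighborhood of `z` in `K`. -/
def LocallyConnectedAt {X : Type*} [TopologicalSpace X] (K : Set X) (z : X) : Prop :=
  ∀ V ∈ 𝓝[K] z, ∃ N ∈ 𝓝[K] z, N ⊆ K ∩ V ∧ IsConnected N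

/-- `φ : ℂ → ℂ∞` is holomorphic, as a map into the Riemann sphere, on `D`:
near every point of `D` it is either given by an analytic `ℂ`-valued function, or by the
reciprocal of one. -/
def HolomorphicIntoSphereOn (φ : ℂ → ℂ∞) (D : Set ℂ) : Prop :=
  ∀ z ∈ D,
    (∃ g : ℂ → ℂ, AnalyticAt ℂ g z ∧ ∀ᶠ w in 𝓝 z, φ w = ((g w : ℂ) : ℂ∞)) ∨
    (∃ g : ℂ → ℂ, AnalyticAt ℂ g z ∧
      ∀ᶠ w in 𝓝 z, φ w = if g w = 0 then (∞ : ℂ∞) else (((g w)⁻¹ : ℂ) : ℂ∞))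

/-- The impression of the prime end `ζ ∈ ∂𝔻` (cluster set of `φ` at `ζ`). -/
def impression (φ : ℂ → ℂ∞) (ζ : ℂ) : Set ℂ∞ :=
  {z | ∃ w : ℕ → ℂ, (∀ j, w j ∈ ball (0 : ℂ) 1) ∧ Tendsto w atTop (𝓝 ζ) ∧
    Tendsto (fun j => φ (w j)) atTop (𝓝 z)}

/-- The set of principal points of the prime end `ζ` (radial cluster set of `φ` at `ζ`). -/
def principalPoints (φ : ℂ → ℂ∞) (ζ : ℂ) : Set ℂ∞ :=
  {z | ∃ t : ℕ → ℝ, (∀ j, t j ∈ Ico (0 : ℝ) 1) ∧ Tendsto t atTop (𝓝 1) ∧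
    Tendsto (fun j => φ ((t j : ℂ) * ζ)) atTop (𝓝 z)}

/-- The accumulation set of a curve `Γ : [0,∞) → ℂ∞`: all limits of sequences `Γ (t j)`
with `t j → ∞`. -/
def accSet (Γ : ℝ → ℂ∞) : Set ℂ∞ :=
  {z | ∃ t : ℕ → ℝ, Tendsto t atTop atTop ∧ Tendsto (fun j => Γ (t j)) atTop (𝓝 z)}

/-- `Γ` is a (continuous) curve `[0,∞) → U`. -/
def IsCurveIn (U : Set ℂ∞) (Γ : ℝ → ℂ∞) : Prop :=
  ContinuousOn Γ (Ici 0) ∧ MapsTo Γ (Ici 0) U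

/-- The curve `Γ : [0,∞) → U` converges to the prime end `ζ`: `φ⁻¹(Γ(t)) = ψ(Γ(t)) → ζ`. -/
def ConvergesToPrimeEnd (U : Set ℂ∞) (ψ : ℂ∞ → ℂ) (Γ : ℝ → ℂ∞) (ζ : ℂ) : Prop :=
  IsCurveIn U Γ ∧ Tendsto (fun t => ψ (Γ t)) atTop (𝓝 ζ)

/-- `Γ` converges to the prime end `ζ` from the left. -/
def ConvergesFromLeft (U : Set ℂ∞) (ψ : ℂ∞ → ℂ) (Γ : ℝ → ℂ∞) (ζ : ℂ) : Prop :=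
  ConvergesToPrimeEnd U ψ Γ ζ ∧ ∀ᶠ t in atTop, 0 ≤ (ψ (Γ t) / ζ).im

/-- `Γ` converges to the prime end `ζ` from the right. -/
def ConvergesFromRight (U : Set ℂ∞) (ψ : ℂ∞ → ℂ) (Γ : ℝ → ℂ∞) (ζ : ℂ) : Prop :=
  ConvergesToPrimeEnd U ψ Γ ζ ∧ ∀ᶠ t in atTop, (ψ (Γ t) / ζ).im ≤ 0

/-- The left wing `I⁺(ζ)` of the prime end `ζ`. -/
def leftWing (U : Set ℂ∞) (ψ : ℂ∞ → ℂ) (ζ : ℂ) : Set ℂ∞ :=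
  {z | ∃ Γ : ℝ → ℂ∞, ConvergesFromLeft U ψ Γ ζ ∧ z ∈ accSet Γ}

/-- The right wing `I⁻(ζ)` of the prime end `ζ`. -/
def rightWing (U : Set ℂ∞) (ψ : ℂ∞ → ℂ) (ζ : ℂ) : Set ℂ∞ :=
  {z | ∃ Γ : ℝ → ℂ∞, ConvergesFromRight U ψ Γ ζ ∧ z ∈ accSet Γ}

/-- `z` has priority over `w` in the left wing of `ζ`. -/
def PriorityLeft (U : Set ℂ∞) (ψ : ℂ∞ → ℂ) (ζ : ℂ) (z w : ℂ∞) : Prop :=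
  ∀ Γ : ℝ → ℂ∞, ConvergesFromLeft U ψ Γ ζ → w ∈ accSet Γ → z ∈ accSet Γ

/-- `z` has priority over `w` in the right wing of `ζ`. -/
def PriorityRight (U : Set ℂ∞) (ψ : ℂ∞ → ℂ) (ζ : ℂ) (z w : ℂ∞) : Prop :=
  ∀ Γ : ℝ → ℂ∞, ConvergesFromRight U ψ Γ ζ → w ∈ accSet Γ → z ∈ accSet Γ

/-- The sequence `w` accumulates at `z` (some subsequence converges to `z`). -/
def SeqAccumAt (w : ℕ → ℂ∞) (z : ℂ∞) : Prop :=
  ∃ n : ℕ → ℕ, StrictMono n ∧ Tendsto (fun j => w (n j)) atTop (𝓝 z)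

/-- `z₀` is strongly minimal in the prime end `ζ`: every sequence in `U` converging to the
prime end `ζ` and not accumulating at `z₀` lies on a curve converging to `ζ` whose
accumulation set misses `z₀`. -/
def StronglyMinimal (U : Set ℂ∞) (ψ : ℂ∞ → ℂ) (ζ : ℂ) (z₀ : ℂ∞) : Prop :=
  ∀ w : ℕ → ℂ∞, (∀ j, w j ∈ U) → Tendsto (fun j => ψ (w j)) atTop (𝓝 ζ) →
    ¬ SeqAccumAt w z₀ →
    ∃ Γ : ℝ → ℂ∞, ConvergesToPrimeEnd U ψ Γ ζ ∧ (∀ j, ∃ t, 0 ≤ t ∧ Γ t = w j) ∧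
      z₀ ∉ accSet Γ


open Filter Topology Metric Set OnePoint

/-- increment of a continuous logarithm -/
noncomputable def logInc (g : ℝ → ℂ) : ℂ :=
  open Classical in
  if h : ∃ L : ℝ → ℂ, Continuous L ∧ ∀ s, Complex.exp (L s) = g s then
    h.choose 1 - h.choose 0 else 0

lemma logInc_eq {g L : ℝ → ℂ} (hL : Continuous L) (h : ∀ s, Complex.exp (L s) = g s) :
    logInc g = L 1 - L 0 := by
  have hex : ∃ L : ℝ → ℂ, Continuous L ∧ ∀ s, Complex.exp (L s) = g s := ⟨L, hL, h⟩
  have e : logInc g = hex.choose 1 - hex.choose 0 := by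
    unfold logInc; rw [dif_pos hex]
  rw [e]
  obtain ⟨h1, h2⟩ := hex.choose_spec
  set M := hex.choose
  have hne : (2 * Real.pi * Complex.I : ℂ) ≠ 0 := by
    simp [Real.pi_ne_zero]
  have key := isPreconnected_univ.constant_of_mapsTo (S := (univ : Set ℝ))
    (T := range (fun n : ℤ => (n : ℂ)))
    (f := fun s => (M s - L s) / (2 * Real.pi * Complex.I))
    (Complex.isClosedEmbedding_intCast.isInducing.isDiscrete_range)
    (by fun_prop) (by
      intro s _
      have : Complex.exp (M s) = Complex.exp (L s) := by rw [h2, h]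
      obtain ⟨n, hn⟩ := Complex.exp_eq_exp_iff_exists_int.1 this
      refine ⟨n, ?_⟩
      simp only []
      rw [eq_div_iff hne, hn]; ring) (mem_univ (1:ℝ)) (mem_univ (0:ℝ))
  rw [div_left_inj' hne] at key
  linear_combination key

lemma exists_log2 (F : ℝ × ℝ → ℂ) (hF : Continuous F) (h0 : ∀ x, F x ≠ 0) :
    ∃ L : ℝ × ℝ → ℂ, Continuous L ∧ ∀ x, Complex.exp (L x) = F x := by
  have cov := Complex.isCoveringMap_exp
  let f : C(ℝ × ℝ, {z : ℂ // z ≠ 0}) := ⟨fun x => ⟨F x, h0 x⟩, by fun_prop⟩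
  obtain ⟨G, ⟨-, hG⟩, -⟩ := cov.existsUnique_continuousMap_lifts f (0, 0)
    (Complex.log (F (0,0))) (by apply Subtype.ext; simp [f, Complex.exp_log (h0 _)])
  refine ⟨G, G.continuous, fun x => ?_⟩
  have := congrFun hG x
  simpa [f] using congrArg Subtype.val this

lemma exists_log1 (g : ℝ → ℂ) (hg : Continuous g) (h0 : ∀ x, g x ≠ 0) :
    ∃ L : ℝ → ℂ, Continuous L ∧ ∀ x, Complex.exp (L x) = g x := by
  obtain ⟨L, hL, h⟩ := exists_log2 (fun x => g x.1) (by fun_prop) (fun x => h0 _)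
  exact ⟨fun s => L (s, 0), by fun_prop, fun s => h _⟩

lemma logInc_mul {g h : ℝ → ℂ} (hg : Continuous g) (hh : Continuous h)
    (g0 : ∀ x, g x ≠ 0) (h0 : ∀ x, h x ≠ 0) :
    logInc (fun s => g s * h s) = logInc g + logInc h := by
  obtain ⟨L, hL, e⟩ := exists_log1 g hg g0
  obtain ⟨M, hM, e'⟩ := exists_log1 h hh h0
  rw [logInc_eq hL e, logInc_eq hM e',
    logInc_eq (L := fun s => L s + M s) (by fun_prop) (fun s => by rw [Complex.exp_add, e, e'])]
  ring

lemma logInc_neg {g : ℝ → ℂ} (hg : Continuous g) (g0 : ∀ x, g x ≠ 0) :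
    logInc (fun s => - g s) = logInc g := by
  obtain ⟨L, hL, e⟩ := exists_log1 g hg g0
  rw [logInc_eq hL e, logInc_eq (L := fun s => L s + Real.pi * Complex.I) (by fun_prop)
    (fun s => by rw [Complex.exp_add, e, Complex.exp_pi_mul_I]; ring)]
  ring

lemma logInc_rect (F : ℝ × ℝ → ℂ) (hF : Continuous F) (h0 : ∀ x, F x ≠ 0) :
    logInc (fun s => F (s, 0)) + logInc (fun t => F (1, t))
      - logInc (fun s => F (s, 1)) - logInc (fun t => F (0, t)) = 0 := by
  obtain ⟨L, hL, h⟩ := exists_log2 F hF h0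
  rw [logInc_eq (L := fun s => L (s, 0)) (by fun_prop) (fun s => h _),
    logInc_eq (L := fun s => L (s, 1)) (by fun_prop) (fun s => h _),
    logInc_eq (L := fun s => L (1, s)) (by fun_prop) (fun s => h _),
    logInc_eq (L := fun s => L (0, s)) (by fun_prop) (fun s => h _)]
  ring

noncomputable def DD (γ : ℝ → ℂ) (y : ℂ) : ℂ := logInc (fun s => γ s - y)

noncomputable def RR (γ μ : ℝ → ℂ) : ℂ :=
  DD γ (μ 0) + DD μ (γ 1) - DD γ (μ 1) - DD μ (γ 0)

lemma RR_zero {γ μ : ℝ → ℂ} (hγ : Continuous γ) (hμ : Continuous μ)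
    (h : ∀ s t, γ s ≠ μ t) : RR γ μ = 0 := by
  have := logInc_rect (fun x => γ x.1 - μ x.2) (by fun_prop) (fun x => sub_ne_zero.2 (h _ _))
  have e : ∀ s, logInc (fun t => γ s - μ t) = logInc (fun t => μ t - γ s) := by
    intro s
    rw [← logInc_neg (by fun_prop) (fun t => sub_ne_zero.2 (h s t).symm)]
    simp
  simp only [e] at this
  exact this

lemma DD_half {γ : ℝ → ℂ} (hγ : Continuous γ) {Q : ℝ} (him : ∀ s, 0 ≤ (γ s).im)
    (hne : ∀ s, γ s ≠ Q) : DD γ Q = Complex.log (γ 1 - Q) - Complex.log (γ 0 - Q) := by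
  have hc : Continuous fun s => Complex.log (γ s - Q) := by
    have : ContinuousOn Complex.log ({z : ℂ | 0 ≤ z.im} ∩ {0}ᶜ) := by
      rintro z ⟨hz, hz0⟩
      by_cases hs : z ∈ Complex.slitPlane
      · exact (continuousAt_clog hs).continuousWithinAt
      · rw [Complex.mem_slitPlane_iff_not_le_zero, not_not] at hs
        rw [Complex.le_def] at hs
        have hre : z.re < 0 := lt_of_le_of_ne hs.1 (fun h => hz0 (Complex.ext h hs.2))
        exact (Complex.continuousWithinAt_log_of_re_neg_of_im_zero hre hs.2).mono inter_subset_left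
    exact this.comp_continuous (by fun_prop)
      (fun s => ⟨by simpa using him s, by simpa using sub_ne_zero.2 (hne s)⟩)
  exact logInc_eq hc (fun s => Complex.exp_log (sub_ne_zero.2 (hne s)))

/-- Core crossing contradiction. -/
lemma crossing {l1 p l2 m1 q m2 : ℝ → ℂ}
    (cl1 : Continuous l1) (cp : Continuous p) (cl2 : Continuous l2)
    (cm1 : Continuous m1) (cq : Continuous q) (cm2 : Continuous m2)
    (il1 : ∀ s, 0 ≤ (l1 s).im) (ip : ∀ s, 0 ≤ (p s).im) (il2 : ∀ s, 0 ≤ (l2 s).im)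
    (im1 : ∀ s, 0 ≤ (m1 s).im) (iq : ∀ s, 0 ≤ (q s).im) (im2 : ∀ s, 0 ≤ (m2 s).im)
    {P1 Q1 P2 Q2 : ℝ} (h1 : P1 < Q1) (h2 : Q1 < P2) (h3 : P2 < Q2)
    (e1 : l1 0 = P1) (e2 : l1 1 = p 0) (e3 : p 1 = l2 0) (e4 : l2 1 = P2)
    (e5 : m1 0 = Q1) (e6 : m1 1 = q 0) (e7 : q 1 = m2 0) (e8 : m2 1 = Q2)
    (d1 : ∀ s t, l1 s ≠ m1 t) (d2 : ∀ s t, l1 s ≠ q t) (d3 : ∀ s t, l1 s ≠ m2 t)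
    (d4 : ∀ s t, p s ≠ m1 t) (d5 : ∀ s t, p s ≠ m2 t)
    (d6 : ∀ s t, l2 s ≠ m1 t) (d7 : ∀ s t, l2 s ≠ q t) (d8 : ∀ s t, l2 s ≠ m2 t) :
    RR p q ≠ 0 := by
  have r1 := RR_zero cl1 cm1 d1
  have r2 := RR_zero cl1 cq d2
  have r3 := RR_zero cl1 cm2 d3
  have r4 := RR_zero cp cm1 d4
  have r5 := RR_zero cp cm2 d5
  have r6 := RR_zero cl2 cm1 d6
  have r7 := RR_zero cl2 cq d7
  have r8 := RR_zero cl2 cm2 d8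
  have a1 := DD_half cl1 il1 (fun s => e5 ▸ d1 s 0)
  have a2 := DD_half cp ip (fun s => e5 ▸ d4 s 0)
  have a3 := DD_half cl2 il2 (fun s => e5 ▸ d6 s 0)
  have a4 := DD_half cl1 il1 (fun s => e8 ▸ d3 s 1)
  have a5 := DD_half cp ip (fun s => e8 ▸ d5 s 1)
  have a6 := DD_half cl2 il2 (fun s => e8 ▸ d8 s 1)
  have b1 := DD_half cm1 im1 (fun s => e1 ▸ (d1 0 s).symm)
  have b2 := DD_half cq iq (fun s => e1 ▸ (d2 0 s).symm)
  have b3 := DD_half cm2 im2 (fun s => e1 ▸ (d3 0 s).symm)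
  have b4 := DD_half cm1 im1 (fun s => e4 ▸ (d6 1 s).symm)
  have b5 := DD_half cq iq (fun s => e4 ▸ (d7 1 s).symm)
  have b6 := DD_half cm2 im2 (fun s => e4 ▸ (d8 1 s).symm)
  have lp : ∀ {x y : ℝ}, x < y → Complex.log ((y:ℂ) - x) = (Real.log (y - x) : ℝ) := by
    intro x y h
    rw [← Complex.ofReal_sub, Complex.ofReal_log (by linarith)]
  have ln : ∀ {x y : ℝ}, x < y → Complex.log ((x:ℂ) - y) = (Real.log (y - x) : ℝ) + Real.pi * Complex.I := by
    intro x y h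
    rw [← Complex.ofReal_sub, Complex.log, Complex.arg_ofReal_of_neg (by linarith),
      Complex.norm_real, Real.norm_eq_abs, abs_of_neg (by linarith), neg_sub]
  simp only [RR, e1, e2, e3, e4, e5, e6, e7, e8, a1, a2, a3, a4, a5, a6, b1, b2, b3, b4, b5, b6,
    lp h1, lp h2, lp h3, lp ((h1.trans h2).trans h3),
    ln h1, ln h2, ln h3, ln ((h1.trans h2).trans h3)]
    at r1 r2 r3 r4 r5 r6 r7 r8
  have : RR p q = - (2 * Real.pi * Complex.I) := by
    simp only [RR, e3, ← e2, ← e6, e7]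
    simp only [e2, e6]
    linear_combination - (r1 + r2 + r3 + r4 + r5 + r6 + r7 + r8)
  rw [this]
  simp [Real.pi_ne_zero]

lemma torus {α β x y : ℝ → ℂ} (cα : Continuous α) (cβ : Continuous β)
    (cx : Continuous x) (cy : Continuous y)
    (x0 : x 0 = α 0) (x1 : x 1 = α 1) (y0 : y 0 = β 0) (y1 : y 1 = β 1)
    (d1 : ∀ s t, α s ≠ y t) (d2 : ∀ s t, x s ≠ β t) (d3 : ∀ s t, x s ≠ y t) :
    RR α β = 0 := by
  have r1 := RR_zero cα cy d1
  have r2 := RR_zero cx cβ d2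
  have r3 := RR_zero cx cy d3
  simp only [RR, x0, x1, y0, y1] at *
  linear_combination r1 + r2 - r3

lemma RR_quot {α β p q : ℝ → ℂ} (cp : Continuous p) (cq : Continuous q)
    (G : ℝ × ℝ → ℂ) (cG : Continuous G) (G0 : ∀ x, G x ≠ 0)
    (hG : ∀ s t, α s - β t = G (s, t) * (p s - q t))
    (d1 : ∀ s, p s ≠ q 0) (d2 : ∀ s, p s ≠ q 1) (d3 : ∀ t, p 0 ≠ q t) (d4 : ∀ t, p 1 ≠ q t) :
    RR α β = RR p q := by
  have r := logInc_rect G cG G0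
  have h1 : ∀ t, (∀ s, p s ≠ q t) → DD α (β t) = logInc (fun s => G (s, t)) + DD p (q t) := by
    intro t ht
    unfold DD
    rw [← logInc_mul (by fun_prop) (by fun_prop) (fun s => G0 _) (fun s => sub_ne_zero.2 (ht s))]
    simp only [hG]
  have h2 : ∀ s, (∀ t, p s ≠ q t) → DD β (α s) = logInc (fun t => G (s, t)) + DD q (p s) := by
    intro s ht
    unfold DD
    rw [← logInc_mul (by fun_prop) (by fun_prop) (fun s => G0 _)
      (fun t => sub_ne_zero.2 (ht t).symm)]
    congr 1; ext t
    linear_combination -hG s t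
  simp only [RR, h1 0 d1, h1 1 d2, h2 0 d3, h2 1 d4]
  linear_combination r

open Filter Topology Metric Set OnePoint

lemma inj_deriv_ne_zero {f : ℂ → ℂ} {Ω : Set ℂ} (hΩ : IsOpen Ω) (hf : DifferentiableOn ℂ f Ω)
    (hinj : InjOn f Ω) {z : ℂ} (hz : z ∈ Ω) : deriv f z ≠ 0 := by
  intro hd
  have hΩz : Ω ∈ 𝓝 z := hΩ.mem_nhds hz
  have ha : AnalyticAt ℂ f z := hf.analyticAt hΩz
  have ha' : AnalyticAt ℂ (fun x => f x - f z) z := by fun_prop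
  have hnt : ¬ ∀ᶠ x in 𝓝 z, f x - f z = 0 := by
    intro h
    have h1 : ∀ᶠ x in 𝓝 z, x = z := by
      filter_upwards [h, hΩz] with x hx hxΩ
      exact hinj hxΩ hz (sub_eq_zero.1 hx)
    have : ∀ᶠ x in 𝓝[≠] z, x = z := h1.filter_mono nhdsWithin_le_nhds
    obtain ⟨x, hx, hx'⟩ := (this.and self_mem_nhdsWithin).exists
    exact hx' hx
  obtain ⟨n, g, hg, hg0, hfg⟩ := (ha'.exists_eventuallyEq_pow_smul_nonzero_iff).2 hnt
  -- n ≥ 2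
  have hn0 : n ≠ 0 := by
    rintro rfl
    have := hfg.self_of_nhds
    simp at this
    exact hg0 this.symm
  have hn1 : n ≠ 1 := by
    rintro rfl
    have h1 : HasDerivAt (fun x => f x - f z) (deriv f z) z :=
      (ha.differentiableAt.hasDerivAt).sub_const _
    have h2 : HasDerivAt (fun x => (x - z) ^ 1 • g x) (1 * g z + (z - z) * deriv g z) z := by
      have := ((hasDerivAt_id z).sub_const z).mul hg.differentiableAt.hasDerivAt
      simp only [pow_one, smul_eq_mul]
      exact this
    have := (h2.congr_of_eventuallyEq hfg).unique h1
    rw [hd] at this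
    simp at this
    exact hg0 this
  -- nth root
  set c := g z with hc
  have hslit : (g z / c) ∈ Complex.slitPlane := by
    rw [div_self hg0]; exact Complex.one_mem_slitPlane
  let h : ℂ → ℂ := fun x => (x - z) * (Complex.exp (Complex.log (g x / c) / n))
  have hh : AnalyticAt ℂ h z := by
    have : AnalyticAt ℂ (fun x => Complex.log (g x / c)) z :=
      AnalyticAt.clog (by fun_prop (disch := exact hg0)) hslit
    have h2 : AnalyticAt ℂ (fun x => Complex.exp (Complex.log (g x / c) / n)) z :=
      (this.div analyticAt_const (by exact_mod_cast hn0)).cexp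
    exact (analyticAt_id.sub analyticAt_const).mul h2
  have hpow : ∀ᶠ x in 𝓝 z, f x - f z = c * (h x) ^ n := by
    have hgne : ∀ᶠ x in 𝓝 z, g x ≠ 0 := hg.continuousAt.eventually_ne hg0
    filter_upwards [hfg, hgne] with x hx hgx
    rw [hx, mul_pow, ← Complex.exp_nat_mul, mul_div_cancel₀ _ (by exact_mod_cast hn0 : (n:ℂ) ≠ 0),
      Complex.exp_log (div_ne_zero hgx hg0), smul_eq_mul]
    field_simp
  have hder : HasStrictDerivAt h 1 z := by
    have h1 := hh.hasStrictDerivAt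
    have : deriv h z = 1 := by
      have hE : DifferentiableAt ℂ (fun x => Complex.exp (Complex.log (g x / c) / n)) z := by
        have : AnalyticAt ℂ (fun x => Complex.log (g x / c)) z :=
          AnalyticAt.clog (by fun_prop (disch := exact hg0)) hslit
        exact (this.div analyticAt_const (by exact_mod_cast hn0)).cexp.differentiableAt
      have := ((hasDerivAt_id z).sub_const z).mul hE.hasDerivAt
      have := this.deriv
      simp only [id, sub_self, zero_mul, add_zero, one_mul, ← hc, div_self hg0, Complex.log_one, zero_div,
        Complex.exp_zero] at this
      exact this
    rwa [this] at h1
  have hmap := hder.map_nhds_eq one_ne_zero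
  have hz0 : h z = 0 := by simp [h]
  rw [hz0] at hmap
  have hev : ∀ᶠ y in 𝓝 (0:ℂ), ∃ x, x ∈ Ω ∧ f x - f z = c * (h x) ^ n ∧ h x = y := by
    rw [← hmap]
    have : ∀ᶠ x in 𝓝 z, x ∈ Ω ∧ f x - f z = c * (h x)^n := Filter.Eventually.and hΩz hpow
    filter_upwards [image_mem_map this] with y hy
    obtain ⟨x, hx, rfl⟩ := hy
    exact ⟨x, hx.1, hx.2, rfl⟩
  set ω := Complex.exp (2 * Real.pi * Complex.I / n)
  have hω := Complex.isPrimitiveRoot_exp n hn0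
  have hev2 : ∀ᶠ y in 𝓝 (0:ℂ), ∃ x, x ∈ Ω ∧ f x - f z = c * (h x) ^ n ∧ h x = ω * y := by
    have : Tendsto (fun y : ℂ => ω * y) (𝓝 0) (𝓝 0) := by
      have : Continuous (fun y : ℂ => ω * y) := by fun_prop
      simpa using this.tendsto 0
    exact this.eventually hev
  have hev3 : ∀ᶠ y in 𝓝[≠] (0:ℂ), y ≠ 0 := self_mem_nhdsWithin
  obtain ⟨y, ⟨⟨x, hx, hx2, hx3⟩, ⟨x', hx', hx2', hx3'⟩⟩, hy⟩ :=
    (((hev.and hev2).filter_mono nhdsWithin_le_nhds).and hev3).exists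
  have : f x = f x' := by
    rw [← sub_left_inj (a := f z), hx2, hx2', hx3, hx3', mul_pow, hω.pow_eq_one, one_mul]
  have hxx := hinj hx hx' this
  rw [hxx, hx3'] at hx3
  have : ω = 1 := by
    have : (ω - 1) * y = 0 := by linear_combination hx3
    rcases mul_eq_zero.1 this with h | h
    · exact sub_eq_zero.1 h
    · exact absurd h hy
  exact hω.ne_one (by omega) this

lemma exists_quot {f : ℂ → ℂ} {Ω : Set ℂ} (hΩ : IsOpen Ω) (hconv : Convex ℝ Ω)
    (hf : DifferentiableOn ℂ f Ω)
    (hinj : InjOn f Ω) {p q : ℝ → ℂ} (cp : Continuous p) (cq : Continuous q)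
    (hp : ∀ s, p s ∈ Ω) (hq : ∀ s, q s ∈ Ω) :
    ∃ G : ℝ × ℝ → ℂ, Continuous G ∧ (∀ x, G x ≠ 0) ∧
      ∀ s t, f (p s) - f (q t) = G (s, t) * (p s - q t) := by
  have hd : ContinuousOn (deriv f) Ω := (hf.deriv hΩ).continuousOn
  let u : ℝ → ℝ := fun r => (projIcc (0:ℝ) 1 zero_le_one r : ℝ)
  have cu : Continuous u := by fun_prop
  have hu : ∀ r, u r ∈ Icc (0:ℝ) 1 := fun r => (projIcc (0:ℝ) 1 zero_le_one r).2
  have hmem : ∀ s t r, q t + (u r : ℂ) * (p s - q t) ∈ Ω := by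
    intro s t r
    have := hconv.add_smul_sub_mem (hq t) (hp s) (hu r)
    simpa using this
  have hcont : Continuous (fun x : (ℝ × ℝ) × ℝ =>
      deriv f (q x.1.2 + (u x.2 : ℂ) * (p x.1.1 - q x.1.2))) := by
    refine hd.comp_continuous (by fun_prop) (fun x => hmem _ _ _)
  let G : ℝ × ℝ → ℂ := fun x => ∫ r in (0:ℝ)..1, deriv f (q x.2 + (u r : ℂ) * (p x.1 - q x.2))
  have hG : ∀ s t, f (p s) - f (q t) = G (s, t) * (p s - q t) := by
    intro s t
    have hder : ∀ r ∈ Set.uIcc (0:ℝ) 1, HasDerivAt (fun r : ℝ => f (q t + (r : ℂ) * (p s - q t)))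
        (deriv f (q t + (u r : ℂ) * (p s - q t)) * (p s - q t)) r := by
      intro r hr
      rw [uIcc_of_le zero_le_one] at hr
      have hur : u r = r := by simp [u, projIcc_of_mem zero_le_one hr]
      have hm := hmem s t r
      rw [hur] at hm ⊢
      have h1 : HasDerivAt f _ (q t + (r : ℂ) * (p s - q t)) :=
        ((hf _ hm).differentiableAt (hΩ.mem_nhds hm)).hasDerivAt
      have h2 : HasDerivAt (fun r : ℝ => q t + (r : ℂ) * (p s - q t)) (p s - q t) r := by
        have := ((Complex.ofRealCLM.hasDerivAt (x := r)).mul_const (p s - q t)).const_add (q t)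
        simpa using this
      exact h1.comp_of_eq r h2 rfl
    have := intervalIntegral.integral_eq_sub_of_hasDerivAt hder (by
      apply Continuous.intervalIntegrable
      exact (hcont.comp (g := _) (f := fun r : ℝ => ((s, t), r)) (by fun_prop)).mul_const _)
    simp only [intervalIntegral.integral_mul_const] at this
    simp only [G]
    rw [this]
    simp
  refine ⟨G, ?_, ?_, hG⟩
  · exact intervalIntegral.continuous_parametric_intervalIntegral_of_continuous' hcont 0 1
  · rintro ⟨s, t⟩
    by_cases h : p s = q t
    · have : G (s, t) = deriv f (q t) := by
        simp [G, h]
      rw [this]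
      exact inj_deriv_ne_zero hΩ hf hinj (hq t)
    · intro h0
      have := hG s t
      rw [h0, zero_mul, sub_eq_zero] at this
      exact h (hinj (hp s) (hq t) this)

/-- final topological contradiction -/
lemma no_interleave {f : ℂ → ℂ} {Ω : Set ℂ} (hΩ : IsOpen Ω) (hconv : Convex ℝ Ω)
    (hf : DifferentiableOn ℂ f Ω) (hinj : InjOn f Ω) (him : ∀ v ∈ Ω, 0 < v.im)
    {Z W : Set ℂ} (hZ : Convex ℝ Z) (hW : Convex ℝ W) (hZW : Disjoint Z W)
    {p q : ℝ → ℂ} (cp : Continuous p) (cq : Continuous q)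
    (hp : ∀ s, p s ∈ Ω) (hq : ∀ s, q s ∈ Ω)
    (hpW : ∀ s, f (p s) ∉ W) (hqZ : ∀ s, f (q s) ∉ Z)
    {P1 Q1 P2 Q2 : ℝ} (h1 : P1 < Q1) (h2 : Q1 < P2) (h3 : P2 < Q2)
    (l1 : JoinedIn ({v | v ∈ Ω ∧ f v ∈ Z} ∪ {(P1 : ℂ)}) (p 0) P1)
    (l2 : JoinedIn ({v | v ∈ Ω ∧ f v ∈ Z} ∪ {(P2 : ℂ)}) (p 1) P2)
    (m1 : JoinedIn ({v | v ∈ Ω ∧ f v ∈ W} ∪ {(Q1 : ℂ)}) (q 0) Q1)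
    (m2 : JoinedIn ({v | v ∈ Ω ∧ f v ∈ W} ∪ {(Q2 : ℂ)}) (q 1) Q2) : False := by
  have hreal : ∀ x : ℝ, (x : ℂ) ∉ Ω := fun x hx => by simpa using him _ hx
  have ext : ∀ {S : Set ℂ} {a b : ℂ}, JoinedIn S a b →
      ∃ g : ℝ → ℂ, Continuous g ∧ g 0 = a ∧ g 1 = b ∧ ∀ s, g s ∈ S := by
    intro S a b h
    refine ⟨h.somePath.extend, h.somePath.continuous_extend, by simp, by simp, fun s => ?_⟩
    exact h.somePath_mem _
  obtain ⟨a1, ca1, a10, a11, ha1⟩ := ext l1.symm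
  obtain ⟨a2, ca2, a20, a21, ha2⟩ := ext l2
  obtain ⟨b1, cb1, b10, b11, hb1⟩ := ext m1.symm
  obtain ⟨b2, cb2, b20, b21, hb2⟩ := ext m2
  have imS : ∀ {Y : Set ℂ} {x : ℝ} {v : ℂ}, v ∈ ({v | v ∈ Ω ∧ f v ∈ Y} ∪ {(x : ℂ)}) → 0 ≤ v.im := by
    rintro Y x v (h | h)
    · exact (him _ h.1).le
    · rw [mem_singleton_iff] at h; simp [h]
  have disj : ∀ {x y : ℝ} {v v' : ℂ}, x ≠ y → v ∈ ({v | v ∈ Ω ∧ f v ∈ Z} ∪ {(x : ℂ)}) →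
      v' ∈ ({v | v ∈ Ω ∧ f v ∈ W} ∪ {(y : ℂ)}) → v ≠ v' := by
    rintro x y v v' hxy (h | h) (h' | h') rfl
    · exact (disjoint_left.1 hZW) h.2 h'.2
    · rw [mem_singleton_iff] at h'; subst h'; exact hreal _ h.1
    · rw [mem_singleton_iff] at h; subst h; exact hreal _ h'.1
    · rw [mem_singleton_iff] at h h'; rw [h] at h'; exact hxy (by exact_mod_cast h')
  have djZ : ∀ {x : ℝ} {v v' : ℂ}, v ∈ ({v | v ∈ Ω ∧ f v ∈ Z} ∪ {(x : ℂ)}) →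
      v' ∈ Ω → f v' ∉ Z → v ≠ v' := by
    rintro x v v' (h | h) h' h'' rfl
    · exact h'' h.2
    · rw [mem_singleton_iff] at h; subst h; exact hreal _ h'
  have djW : ∀ {x : ℝ} {v v' : ℂ}, v ∈ ({v | v ∈ Ω ∧ f v ∈ W} ∪ {(x : ℂ)}) →
      v' ∈ Ω → f v' ∉ W → v ≠ v' := by
    rintro x v v' (h | h) h' h'' rfl
    · exact h'' h.2
    · rw [mem_singleton_iff] at h; subst h; exact hreal _ h'
  have inS : ∀ {Y : Set ℂ} {x : ℝ} {v : ℂ}, v ∈ Ω → v ∈ ({v | v ∈ Ω ∧ f v ∈ Y} ∪ {(x : ℂ)}) →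
      f v ∈ Y := by
    rintro Y x v hv (h | h)
    · exact h.2
    · rw [mem_singleton_iff] at h; subst h; exact absurd hv (hreal _)
  have fp0 := inS (hp 0) l1.source_mem
  have fp1 := inS (hp 1) l2.source_mem
  have fq0 := inS (hq 0) m1.source_mem
  have fq1 := inS (hq 1) m2.source_mem
  have nz := crossing ca1 cp ca2 cb1 cq cb2 (fun s => imS (ha1 s)) (fun s => (him _ (hp s)).le)
    (fun s => imS (ha2 s)) (fun s => imS (hb1 s)) (fun s => (him _ (hq s)).le)
    (fun s => imS (hb2 s)) h1 h2 h3 a10 a11 a20.symm a21 b10 b11 b20.symm b21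
    (fun s t => disj h1.ne (ha1 s) (hb1 t)) (fun s t => djZ (ha1 s) (hq t) (hqZ t))
    (fun s t => disj (by linarith [h1, h2, h3] : P1 < Q2).ne (ha1 s) (hb2 t))
    (fun s t => (djW (hb1 t) (hp s) (hpW s)).symm)
    (fun s t => (djW (hb2 t) (hp s) (hpW s)).symm)
    (fun s t => disj h2.ne' (ha2 s) (hb1 t)) (fun s t => djZ (ha2 s) (hq t) (hqZ t))
    (fun s t => disj h3.ne (ha2 s) (hb2 t))
  obtain ⟨G, cG, G0, hG⟩ := exists_quot hΩ hconv hf hinj cp cq hp hq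
  obtain ⟨x, cx, x0, x1, hx⟩ := ext (hZ.isPathConnected ⟨_, fp0⟩ |>.joinedIn _ fp0 _ fp1)
  obtain ⟨y, cy, y0, y1, hy⟩ := ext (hW.isPathConnected ⟨_, fq0⟩ |>.joinedIn _ fq0 _ fq1)
  have hfc := hf.continuousOn
  have z := torus (α := fun s => f (p s)) (β := fun s => f (q s)) (hfc.comp_continuous cp hp)
    (hfc.comp_continuous cq hq) cx cy x0 x1 y0 y1
    (fun s t h => hpW s (by rw [h]; exact hy t))
    (fun s t h => hqZ t (by rw [← h]; exact hx s))
    (fun s t h => disjoint_left.1 hZW (hx s) (by rw [h]; exact hy t))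
  rw [RR_quot cp cq G cG G0 hG (fun s h => hpW s (by rw [h]; exact fq0))
    (fun s h => hpW s (by rw [h]; exact fq1)) (fun s h => hqZ s (by rw [← h]; exact fp0))
    (fun s h => hqZ s (by rw [← h]; exact fp1))] at z
  exact nz z

open Filter Topology Metric Set OnePoint

open MeasureTheory in
lemma area_formula {f : ℂ → ℂ} {Ω : Set ℂ} (hΩ : IsOpen Ω) (hf : DifferentiableOn ℂ f Ω)
    (hinj : InjOn f Ω) :
    ∫⁻ x in Ω, ENNReal.ofReal (‖deriv f x‖ ^ 2) = volume (f '' Ω) := by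
  have := lintegral_image_eq_lintegral_abs_det_fderiv_mul (volume : Measure ℂ) (s := Ω) (f := f)
    (f' := fun x => (ContinuousLinearMap.toSpanSingleton ℂ (deriv f x)).restrictScalars ℝ)
    hΩ.measurableSet (fun x hx => by
      have h := ((hf x hx).differentiableAt (hΩ.mem_nhds hx)).hasDerivAt.hasFDerivAt
      exact (h.restrictScalars ℝ).hasFDerivWithinAt) hinj (fun _ => 1)
  simp only [mul_one, lintegral_const, Measure.restrict_apply MeasurableSet.univ, univ_inter,
    one_mul] at this
  rw [this]
  refine lintegral_congr fun x => ?_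
  congr 1
  have : ((ContinuousLinearMap.toSpanSingleton ℂ (deriv f x)).restrictScalars ℝ).det
      = Complex.normSq (deriv f x) := by
    rw [← Algebra.norm_complex_apply, Algebra.norm_apply]
    simp only [ContinuousLinearMap.det]
    congr 1
    ext; simp [mul_comm]
  rw [this, Complex.normSq_eq_norm_sq, abs_of_nonneg (by positivity)]

open MeasureTheory in
lemma length_area {f : ℂ → ℂ} {Ω : Set ℂ} (hΩ : IsOpen Ω) (hf : DifferentiableOn ℂ f Ω)
    (hinj : InjOn f Ω) {M : ℝ} (hM : 0 < M) (hvol : volume (f '' Ω) ≤ ENNReal.ofReal M)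
    {c : ℂ} {r1 a b : ℝ} (hr1 : 0 < r1) (hab : Ioo a b ⊆ Ioo (-Real.pi) Real.pi)
    (hS : ∀ r ∈ Ioo r1 (2 * r1), ∀ θ ∈ Ioo a b, c + r * Complex.exp (θ * Complex.I) ∈ Ω) :
    ∃ r ∈ Ioo r1 (2 * r1), ∀ θ₁ ∈ Ioo a b, ∀ θ₂ ∈ Ioo a b,
      dist (f (c + r * Complex.exp (θ₁ * Complex.I))) (f (c + r * Complex.exp (θ₂ * Complex.I)))
        ≤ 5 * √M := by
  let h : ℂ → ENNReal := Ω.indicator (fun x => ENNReal.ofReal (‖deriv f x‖ ^ 2))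
  have hmeas : Measurable h := by
    refine Measurable.indicator ?_ hΩ.measurableSet
    exact ((measurable_deriv f).norm.pow_const 2).ennreal_ofReal
  have h1 : ∫⁻ x, h (c + x) ≤ ENNReal.ofReal M := by
    rw [lintegral_add_left_eq_self (μ := volume) h c, lintegral_indicator hΩ.measurableSet, area_formula hΩ hf hinj]
    exact hvol
  rw [← Complex.lintegral_comp_polarCoord_symm] at h1
  have hsub : Ioo r1 (2 * r1) ×ˢ Ioo a b ⊆ polarCoord.target := by
    rw [polarCoord_target]
    exact prod_mono (fun r hr => lt_trans hr1 hr.1) hab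
  have hmeas2 : Measurable (fun p : ℝ × ℝ =>
      ENNReal.ofReal p.1 • h (c + Complex.polarCoord.symm p)) := by
    refine Measurable.mul (measurable_fst.ennreal_ofReal) (hmeas.comp ?_)
    have : Continuous fun p : ℝ × ℝ => c + Complex.polarCoord.symm p := by
      simp only [Complex.polarCoord_symm_apply]
      fun_prop
    exact this.measurable
  have h2 := (lintegral_mono_set hsub).trans h1
  rw [Measure.volume_eq_prod, setLIntegral_prod _ hmeas2.aemeasurable] at h2
  set J : ℝ → ENNReal := fun r => ∫⁻ y in Ioo a b, ENNReal.ofReal r • h (c + Complex.polarCoord.symm (r, y))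
  have hJ : Measurable J := hmeas2.lintegral_prod_right'
  have hvolI : volume (Ioo r1 (2 * r1)) = ENNReal.ofReal r1 := by
    rw [Real.volume_Ioo]; congr 1; ring
  obtain ⟨r, hr, hJr⟩ := exists_le_setLAverage (μ := volume) (s := Ioo r1 (2 * r1)) (f := J)
    (by rw [hvolI]; simpa using hr1) (by rw [hvolI]; exact ENNReal.ofReal_ne_top) hJ.aemeasurable
  have hJ2 : J r ≤ ENNReal.ofReal (M / r1) := by
    refine hJr.trans ?_
    rw [setLAverage_eq, hvolI, ENNReal.ofReal_div_of_pos hr1]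
    gcongr
  refine ⟨r, hr, ?_⟩
  have hr0 : 0 < r := hr1.trans hr.1
  let γ : ℝ → ℂ := fun θ => c + r * Complex.exp (θ * Complex.I)
  have cγ : Continuous γ := by fun_prop
  have hd : ContinuousOn (deriv f) Ω := (hf.deriv hΩ).continuousOn
  suffices H : ∀ θ₁ ∈ Ioo a b, ∀ θ₂ ∈ Ioo a b, θ₁ ≤ θ₂ → dist (f (γ θ₁)) (f (γ θ₂)) ≤ 5 * √M by
    intro θ₁ h₁ θ₂ h₂
    rcases le_total θ₁ θ₂ with h | h
    · exact H _ h₁ _ h₂ h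
    · rw [dist_comm]; exact H _ h₂ _ h₁ h
  intro θ₁ h₁ θ₂ h₂ hle
  have hIcc : Icc θ₁ θ₂ ⊆ Ioo a b := fun x hx => ⟨h₁.1.trans_le hx.1, hx.2.trans_lt h₂.2⟩
  have hγΩ : ∀ θ ∈ Icc θ₁ θ₂, γ θ ∈ Ω := fun θ hθ => hS r hr θ (hIcc hθ)
  have cder : ContinuousOn (fun θ => deriv f (γ θ)) (Icc θ₁ θ₂) :=
    hd.comp cγ.continuousOn hγΩ
  have hder : ∀ θ ∈ Set.uIcc θ₁ θ₂, HasDerivAt (fun θ => f (γ θ))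
      (deriv f (γ θ) * (r * (Complex.exp (θ * Complex.I) * Complex.I))) θ := by
    intro θ hθ
    rw [uIcc_of_le hle] at hθ
    have k1 : HasDerivAt f _ (γ θ) :=
        ((hf _ (hγΩ θ hθ)).differentiableAt (hΩ.mem_nhds (hγΩ θ hθ))).hasDerivAt
    have k2 : HasDerivAt γ (r * (Complex.exp (θ * Complex.I) * Complex.I)) θ := by
      have e : HasDerivAt (fun θ : ℝ => (θ : ℂ) * Complex.I) Complex.I θ := by
        simpa using (Complex.ofRealCLM.hasDerivAt (x := θ)).mul_const Complex.I
      exact ((e.cexp).const_mul (r : ℂ)).const_add c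
    exact k1.comp_of_eq θ k2 rfl
  have cint : ContinuousOn (fun θ : ℝ => deriv f (γ θ) * (r * (Complex.exp (θ * Complex.I) * Complex.I)))
      (Icc θ₁ θ₂) := cder.mul (by fun_prop)
  have hFTC := intervalIntegral.integral_eq_sub_of_hasDerivAt hder
    (ContinuousOn.intervalIntegrable (by rwa [uIcc_of_le hle]))
  have hsq : ContinuousOn (fun θ => r * ‖deriv f (γ θ)‖ ^ 2) (Icc θ₁ θ₂) := by fun_prop
  have hI2 : ∫ θ in θ₁..θ₂, r * ‖deriv f (γ θ)‖ ^ 2 ≤ M / r1 := by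
    rw [intervalIntegral.integral_of_le hle]
    have hint : IntegrableOn (fun θ => r * ‖deriv f (γ θ)‖ ^ 2) (Ioc θ₁ θ₂) :=
      (hsq.integrableOn_Icc).mono_set Ioc_subset_Icc_self
    rw [← ENNReal.ofReal_le_ofReal_iff (by positivity),
      ofReal_integral_eq_lintegral_ofReal hint (Eventually.of_forall fun θ => by positivity)]
    refine le_trans ?_ hJ2
    refine le_trans (le_of_eq ?_) (lintegral_mono_set (Ioc_subset_Icc_self.trans hIcc))
    refine setLIntegral_congr_fun measurableSet_Ioc (fun θ hθ => ?_)
    have hm := hγΩ θ (Ioc_subset_Icc_self hθ)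
    have e : c + Complex.polarCoord.symm (r, θ) = γ θ := by
      simp only [Complex.polarCoord_symm_apply, γ, Complex.exp_mul_I]
      push_cast; ring
    simp only [e, h, indicator_of_mem hm, smul_eq_mul]
    rw [ENNReal.ofReal_mul hr0.le]
  have hsM : 0 < √M := Real.sqrt_pos.2 hM
  have hss : √M * √M = M := Real.mul_self_sqrt hM.le
  rw [dist_comm, dist_eq_norm, ← hFTC]
  calc ‖∫ θ in θ₁..θ₂, deriv f (γ θ) * (r * (Complex.exp (θ * Complex.I) * Complex.I))‖
      ≤ ∫ θ in θ₁..θ₂, (√M / 2 + (r / (2 * √M)) * (r * ‖deriv f (γ θ)‖ ^ 2)) := by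
        refine intervalIntegral.norm_integral_le_of_norm_le hle ?_ ?_
        · refine Eventually.of_forall fun θ hθ => ?_
          have : ‖deriv f (γ θ) * (r * (Complex.exp (θ * Complex.I) * Complex.I))‖
              = r * ‖deriv f (γ θ)‖ := by
            simp only [norm_mul, Complex.norm_exp_ofReal_mul_I, Complex.norm_I, Complex.norm_real,
              Real.norm_eq_abs, abs_of_pos hr0]
            ring
          rw [this]
          set x := ‖deriv f (γ θ)‖
          have : √M / 2 + (r / (2 * √M)) * (r * x ^ 2) - r * x = (√M - r * x)^2 / (2 * √M) := by
            field_simp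
            ring
          have : 0 ≤ (√M - r * x)^2 / (2 * √M) := by positivity
          linarith
        · apply ContinuousOn.intervalIntegrable
          rw [uIcc_of_le hle]
          fun_prop
    _ = (θ₂ - θ₁) * (√M / 2) + (r / (2 * √M)) * ∫ θ in θ₁..θ₂, (r * ‖deriv f (γ θ)‖ ^ 2) := by
        rw [intervalIntegral.integral_add, intervalIntegral.integral_const,
          intervalIntegral.integral_const_mul, smul_eq_mul]
        · simp
        · apply ContinuousOn.intervalIntegrable
          rw [uIcc_of_le hle]
          fun_prop
    _ ≤ (2 * Real.pi) * (√M / 2) + (r / (2 * √M)) * (M / r1) := by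
        have := (hab h₁).1
        have := (hab h₂).2
        gcongr
        linarith
    _ ≤ 5 * √M := by
        have k : (r / (2 * √M)) * (M / r1) = (r / (2 * r1)) * √M := by
          rw [← hss]; field_simp; simp
        rw [k]
        have : r / (2 * r1) ≤ 1 := by
          rw [div_le_one (by positivity)]; exact hr.2.le
        have := Real.pi_lt_four
        nlinarith

open Filter Topology Metric Set OnePoint

/-- half ball -/
def HB (x r : ℝ) : Set ℂ := {v | 0 < v.im} ∩ ball (x : ℂ) r

lemma HB_open (x r : ℝ) : IsOpen (HB x r) :=
  (isOpen_lt continuous_const Complex.continuous_im).inter isOpen_ball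

lemma HB_convex (x r : ℝ) : Convex ℝ (HB x r) :=
  (convex_halfSpace_im_gt 0).inter (convex_ball _ _)

open MeasureTheory in
lemma vol_small {f : ℂ → ℂ} {Ω : Set ℂ} (hf : DifferentiableOn ℂ f Ω)
    (hinj : InjOn f Ω) (hvol : volume (f '' Ω) ≠ ⊤) {x η₀ : ℝ} (hη₀ : 0 < η₀) (hsub : HB x η₀ ⊆ Ω)
    {M : ℝ} (hM : 0 < M) :
    ∃ η, 0 < η ∧ η ≤ η₀ ∧ volume (f '' HB x η) ≤ ENNReal.ofReal M := by
  let s : ℕ → Set ℂ := fun n => f '' HB x (η₀ / (n + 1))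
  have hle : ∀ n : ℕ, η₀ / (n + 1) ≤ η₀ := fun n => div_le_self hη₀.le (by simp)
  have hsub' : ∀ n : ℕ, HB x (η₀ / (n + 1)) ⊆ Ω := fun n =>
    (inter_subset_inter_right _ (ball_subset_ball (hle n))).trans hsub
  have hmeas : ∀ n, NullMeasurableSet (s n) volume := fun n =>
    ((HB_open _ _).measurableSet.image_of_continuousOn_injOn (hf.continuousOn.mono (hsub' n))
      (hinj.mono (hsub' n))).nullMeasurableSet
  have hanti : Antitone s := by
    intro m n hmn
    refine image_mono (inter_subset_inter_right _ (ball_subset_ball ?_))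
    gcongr
  have hlim := tendsto_measure_iInter_atTop hmeas hanti
    ⟨0, ((measure_mono (image_mono (hsub' 0))).trans_lt hvol.lt_top).ne⟩
  have hempty : ⋂ n, s n = ∅ := by
    rw [eq_empty_iff_forall_notMem]
    intro y hy
    rw [mem_iInter] at hy
    obtain ⟨v, hv, rfl⟩ := hy 0
    have hall : ∀ n : ℕ, dist v x < η₀ / (n + 1) := by
      intro n
      obtain ⟨v', hv', he⟩ := hy n
      have := hinj (hsub' n hv') (hsub' 0 hv) he
      subst this
      exact hv'.2
    have hlim : Tendsto (fun n : ℕ => η₀ / ((n : ℝ) + 1)) atTop (𝓝 0) := by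
      have := (tendsto_one_div_add_atTop_nhds_zero_nat (𝕜 := ℝ)).const_mul η₀
      simpa [div_eq_mul_inv] using this
    have : dist v x ≤ 0 := ge_of_tendsto' hlim (fun n => (hall n).le)
    have : v = x := dist_le_zero.1 this
    have := hv.1
    simp_all
  rw [hempty, measure_empty] at hlim
  obtain ⟨n, hn⟩ := (hlim.eventually (gt_mem_nhds (ENNReal.ofReal_pos.2 hM))).exists
  exact ⟨η₀ / (n + 1), by positivity, hle n, hn.le⟩

lemma polar_repr (c v : ℂ) : c + (dist v c : ℝ) * Complex.exp (Complex.arg (v - c) * Complex.I) = v := by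
  rw [dist_eq_norm, Complex.norm_mul_exp_arg_mul_I]; ring

open MeasureTheory in
lemma scale_semi {f : ℂ → ℂ} {Ω : Set ℂ} (hf : DifferentiableOn ℂ f Ω)
    (hinj : InjOn f Ω) (hvol : volume (f '' Ω) ≠ ⊤) {x η₀ : ℝ} (hη₀ : 0 < η₀) (hsub : HB x η₀ ⊆ Ω)
    {ε : ℝ} (hε : 0 < ε) :
    ∃ η, 0 < η ∧ ∀ r, 0 < r → r < η → ∃ r' ∈ Ioo r (2 * r), ∀ v₁ v₂ : ℂ,
      0 < v₁.im → 0 < v₂.im → dist v₁ x = r' → dist v₂ x = r' → dist (f v₁) (f v₂) ≤ ε := by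
  obtain ⟨η, hη, hηle, hv⟩ := vol_small hf hinj hvol hη₀ hsub (M := (ε / 5) ^ 2) (by positivity)
  have hs : HB x η ⊆ Ω := (inter_subset_inter_right _ (ball_subset_ball hηle)).trans hsub
  refine ⟨η / 2, by positivity, fun r hr hrη => ?_⟩
  obtain ⟨r', hr', h⟩ := length_area (HB_open x η) (hf.mono hs) (hinj.mono hs) (by positivity) hv
    (c := x) (r1 := r) (a := 0) (b := Real.pi) hr
    (Ioo_subset_Ioo_left (by linarith [Real.pi_pos])) (by
      intro s hs θ hθ
      have hs0 : 0 < s := hr.trans hs.1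
      refine ⟨?_, ?_⟩
      · simp only [mem_setOf_eq, Complex.exp_mul_I]
        rw [← Complex.ofReal_cos, ← Complex.ofReal_sin]
        simp
        exact mul_pos hs0 (Real.sin_pos_of_mem_Ioo hθ)
      · simp [abs_of_pos hs0, Complex.norm_exp_ofReal_mul_I]
        linarith [hs.2])
  refine ⟨r', hr', fun v₁ v₂ h₁ h₂ d₁ d₂ => ?_⟩
  have harg : ∀ v : ℂ, 0 < v.im → Complex.arg (v - x) ∈ Ioo 0 Real.pi := by
    intro v hv
    have him : 0 < (v - x).im := by simpa using hv
    refine ⟨lt_of_le_of_ne (Complex.arg_nonneg_iff.2 him.le) ?_, lt_of_le_of_ne (Complex.arg_le_pi _) ?_⟩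
    · intro h
      rw [eq_comm, Complex.arg_eq_zero_iff] at h
      exact him.ne' h.2
    · intro h
      rw [Complex.arg_eq_pi_iff] at h
      exact him.ne' h.2
  have := h _ (harg v₁ h₁) _ (harg v₂ h₂)
  have e₁ := polar_repr x v₁
  have e₂ := polar_repr x v₂
  rw [d₁] at e₁
  rw [d₂] at e₂
  rw [e₁, e₂, Real.sqrt_sq (by positivity)] at this
  linarith

open MeasureTheory in
lemma scale_vert {f : ℂ → ℂ} {Ω : Set ℂ} (hf : DifferentiableOn ℂ f Ω)
    (hinj : InjOn f Ω) (hvol : volume (f '' Ω) ≠ ⊤) {η₀ : ℝ} (hη₀ : 0 < η₀) (hsub : HB 0 η₀ ⊆ Ω)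
    {ε : ℝ} (hε : 0 < ε) :
    ∃ η, 0 < η ∧ ∀ r : ℝ, 0 < r → r < η → ∀ y : ℝ, y ∈ Icc (r / 2) r →
      dist (f ((y:ℂ) * Complex.I)) (f ((r:ℂ) * Complex.I)) ≤ ε := by
  obtain ⟨η, hη, hηle, hv⟩ := vol_small hf hinj hvol hη₀ hsub (M := (ε / 10) ^ 2) (by positivity)
  have hs : HB 0 η ⊆ Ω := (inter_subset_inter_right _ (ball_subset_ball hηle)).trans hsub
  refine ⟨η / 2, by positivity, fun r hr hrη => ?_⟩
  set c : ℂ := r * Complex.I with hc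
  have hball : ∀ s, s < r → closedBall c s ⊆ HB 0 η := by
    intro s hs v hv
    rw [mem_closedBall, dist_eq_norm] at hv
    refine ⟨?_, ?_⟩
    · have h1 := Complex.abs_im_le_norm (v - c)
      have h2 := neg_abs_le (v - c).im
      have : (v - c).im = v.im - r := by simp [hc]
      simp only [mem_setOf_eq]
      linarith
    · have : ‖v‖ ≤ ‖v - c‖ + ‖c‖ := by simpa using norm_add_le (v - c) c
      have hcn : ‖c‖ = r := by simp [hc, abs_of_pos hr]
      simp
      linarith
  have hcirc : ∀ s, 0 < s → ∀ θ : ℝ, c + s * Complex.exp (θ * Complex.I) ∈ closedBall c s := by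
    intro s hs θ
    simp [abs_of_pos hs, Complex.norm_exp_ofReal_mul_I]
  obtain ⟨r', hr', h⟩ := length_area (HB_open 0 η) (hf.mono hs) (hinj.mono hs) (by positivity) hv
    (c := c) (r1 := r / 2) (a := -Real.pi) (b := Real.pi) (by positivity)
    subset_rfl (by
      intro s hs θ hθ
      exact hball s (by linarith [hs.2]) (hcirc s (by linarith [hs.1]) θ))
  have hr'r : r' < r := by linarith [hr'.2]
  have hr'0 : 0 < r' := by linarith [hr'.1]
  rw [Real.sqrt_sq (by positivity)] at h
  have hfc := hf.continuousOn
  set v0 := f (c + r' * Complex.exp ((0:ℝ) * Complex.I)) with hv0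
  have hall : ∀ θ ∈ Icc (-Real.pi) Real.pi, dist (f (c + r' * Complex.exp (θ * Complex.I))) v0 ≤ ε / 2 := by
    have hcl : IsClosed {θ : ℝ | dist (f (c + r' * Complex.exp (θ * Complex.I))) v0 ≤ ε / 2} := by
      refine isClosed_le (Continuous.dist ?_ continuous_const) continuous_const
      exact hfc.comp_continuous (by fun_prop) (fun θ => hs (hball r' hr'r (hcirc r' hr'0 θ)))
    have hsub : Ioo (-Real.pi) Real.pi ⊆ {θ : ℝ | dist (f (c + r' * Complex.exp (θ * Complex.I))) v0 ≤ ε / 2} := by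
      intro θ hθ
      have := h θ hθ 0 ⟨by linarith [Real.pi_pos], Real.pi_pos⟩
      simp only [mem_setOf_eq]
      linarith
    have := closure_minimal hsub hcl
    rwa [closure_Ioo (by have := Real.pi_pos; intro h; linarith : -Real.pi ≠ Real.pi)] at this
  have hsph : ∀ v ∈ sphere c r', ‖f v - v0‖ ≤ ε / 2 := by
    intro v hv
    have e := polar_repr c v
    rw [mem_sphere.1 hv] at e
    rw [← e, ← dist_eq_norm]
    exact hall _ ⟨(Complex.neg_pi_lt_arg _).le, Complex.arg_le_pi _⟩
  have hin : ∀ v ∈ closedBall c r', ‖f v - v0‖ ≤ ε / 2 := by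
    intro v hv
    refine Complex.norm_le_of_forall_mem_frontier_norm_le (f := fun v => f v - v0) (U := ball c r') isBounded_ball ?_ ?_ ?_
    · apply DifferentiableOn.diffContOnCl
      rw [closure_ball _ hr'0.ne']
      exact (hf.mono ((hball r' hr'r).trans hs)).sub_const _
    · rw [frontier_ball _ hr'0.ne']; exact hsph
    · rwa [closure_ball _ hr'0.ne']
  intro y hy
  have k1 := hin (y * Complex.I) (by
    rw [mem_closedBall, dist_eq_norm, hc, ← sub_mul, norm_mul, Complex.norm_I, mul_one,
      ← Complex.ofReal_sub, Complex.norm_real, Real.norm_eq_abs, abs_le]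
    constructor <;> linarith [hy.1, hy.2, hr'.1])
  have k2 := hin c (mem_closedBall_self hr'0.le)
  rw [← dist_eq_norm] at k1 k2
  linarith [dist_triangle_right (f (y * Complex.I)) (f c) v0]

open MeasureTheory in
lemma avoid {f : ℂ → ℂ} {ρ : ℝ} (hρ : 0 < ρ) (hf : DifferentiableOn ℂ f (HB 0 ρ))
    (hinj : InjOn f (HB 0 ρ)) (hvol : volume (f '' (HB 0 ρ)) ≠ ⊤)
    {q : ℝ → ℂ} {T : ℝ} (hq : ContinuousOn q (Ici T)) (hqΩ : ∀ t ≥ T, q t ∈ HB 0 ρ)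
    (hq0 : Tendsto q atTop (𝓝 0)) {w : ℂ} {δ : ℝ} (hδ : 0 < δ)
    (hqw : ∀ t ≥ T, δ ≤ dist (f (q t)) w) :
    ∃ η, 0 < η ∧ (∀ y : ℝ, 0 < y → y < η → δ / 2 ≤ dist (f (y * Complex.I)) w) ∧
      ∀ r, 0 < r → r < η → ∃ r' ∈ Ioo r (2 * r), ∀ v : ℂ, 0 < v.im → ‖v‖ = r' →
        δ / 2 ≤ dist (f v) w := by
  obtain ⟨η₁, hη₁, h1⟩ := scale_semi hf hinj hvol hρ subset_rfl (ε := δ / 4) (by positivity)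
  obtain ⟨η₂, hη₂, h2⟩ := scale_vert hf hinj hvol hρ subset_rfl (ε := δ / 4) (by positivity)
  have hqT : 0 < ‖q T‖ := by
    have := (hqΩ T le_rfl).1
    simp only [mem_setOf_eq] at this
    exact norm_pos_iff.2 (fun h => by simp [h] at this)
  have key : ∀ r, 0 < r → r < min η₁ (‖q T‖ / 2) → ∃ r' ∈ Ioo r (2 * r), ∀ v : ℂ, 0 < v.im → ‖v‖ = r' →
        3 * δ / 4 ≤ dist (f v) w := by
    intro r hr hrm
    obtain ⟨r', hr', h⟩ := h1 r hr (hrm.trans_le (min_le_left _ _))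
    refine ⟨r', hr', fun v hv hvr => ?_⟩
    have hlt : r' < ‖q T‖ := by linarith [hr'.2, hrm.trans_le (min_le_right _ _)]
    have hr'0 : 0 < r' := hr.trans hr'.1
    obtain ⟨t1, ht1, ht1'⟩ : ∃ t1 ≥ T, ‖q t1‖ < r' := by
      have := hq0.norm
      rw [norm_zero] at this
      obtain ⟨t, ht⟩ := ((this.eventually (gt_mem_nhds hr'0)).and (eventually_ge_atTop T)).exists
      exact ⟨t, ht.2, ht.1⟩
    have hc : ContinuousOn (fun t => ‖q t‖) (Icc T t1) := (hq.mono Icc_subset_Ici_self).norm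
    obtain ⟨t, ht, hqt⟩ := intermediate_value_Icc' ht1 hc ⟨ht1'.le, hlt.le⟩
    have h3 := h v (q t) hv (hqΩ t ht.1).1 (by simpa using hvr) (by simpa using hqt)
    have h4 := hqw t ht.1
    have := dist_triangle (f (q t)) (f v) w
    rw [dist_comm (f (q t)) (f v)] at this
    linarith
  refine ⟨min (min η₁ (‖q T‖ / 2)) η₂, by positivity, fun y hy hyη => ?_, fun r hr hrη => ?_⟩
  · obtain ⟨r', hr', h⟩ := key (y / 2) (by positivity)
      (by linarith [hyη.trans_le (min_le_left _ _)])
    have hr'0 : 0 < r' := by linarith [hr'.1]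
    have h3 := h (r' * Complex.I) (by simpa using hr'0) (by simp [abs_of_pos hr'0])
    have h4 := h2 y hy (hyη.trans_le (min_le_right _ _)) r' ⟨hr'.1.le, by linarith [hr'.2]⟩
    have := dist_triangle (f (r' * Complex.I)) (f (y * Complex.I)) w
    linarith
  · obtain ⟨r', hr', h⟩ := key r hr (hrη.trans_le (min_le_left _ _))
    exact ⟨r', hr', fun v hv hvr => by linarith [h v hv hvr]⟩

open MeasureTheory in
lemma landing {f : ℂ → ℂ} {ρ : ℝ} (hf : DifferentiableOn ℂ f (HB 0 ρ))
    (hinj : InjOn f (HB 0 ρ)) (hvol : volume (f '' (HB 0 ρ)) ≠ ⊤) {z : ℂ} {δ η σ : ℝ}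
    (hη : 0 < η)
    (hvert : ∀ y : ℝ, 0 < y → y < η → δ ≤ dist (f (y * Complex.I)) z)
    (hgood : ∀ r, 0 < r → r < η → ∃ r' ∈ Ioo r (2 * r), ∀ v : ℂ, 0 < v.im → ‖v‖ = r' →
        δ ≤ dist (f v) z)
    (hreach : ∀ a ∈ HB 0 ρ, ∃ x : ℝ → ℂ, ContinuousOn x (Ico 0 1) ∧ x 0 = a ∧
      (∀ t ∈ Ico (0:ℝ) 1, 0 < (x t).im) ∧
      (∀ t ∈ Ico (0:ℝ) 1, x t ∈ HB 0 ρ → dist (f (x t)) z ≤ dist (f a) z) ∧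
      (∀ P : ℂ, 0 < P.im → ¬ MapClusterPt P (𝓝[<] 1) x))
    (hσ : σ = 1 ∨ σ = -1) {κ : ℝ} (hκ : 0 < κ) (hκρ : κ ≤ ρ) :
    ∃ κ', 0 < κ' ∧ ∀ a ∈ HB 0 ρ, ‖a‖ < κ' → 0 ≤ σ * a.re → dist (f a) z < δ →
      ∃ P : ℝ, 0 < σ * P ∧ |P| < κ ∧
        JoinedIn ({v | v ∈ HB 0 ρ ∧ f v ∈ ball z δ} ∪ {(P : ℂ)}) a P := by
  set κ₀ := min κ η with hκ₀
  have hκ₀0 : 0 < κ₀ := lt_min hκ hη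
  obtain ⟨R, hR, hRg⟩ := hgood (κ₀ / 2) (by positivity) (by linarith [min_le_right κ η])
  have hRκ : R < κ₀ := by linarith [hR.2]
  refine ⟨κ₀ / 2, by positivity, fun a ha han hare had => ?_⟩
  obtain ⟨x, cx, x0, xim, xd, xcl⟩ := hreach a ha
  have ha0 : 0 < ‖a‖ := norm_pos_iff.2 (fun h => by have := ha.1; simp [h] at this)
  obtain ⟨R', hR', hRg'⟩ := hgood (‖a‖ / 2) (by positivity)
    (by linarith [min_le_right κ η])
  have hR'a : R' < ‖a‖ := by linarith [hR'.2]
  have hR'0 : 0 < R' := by linarith [hR'.1]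
  have hHB : ∀ {v : ℂ}, 0 < v.im → ‖v‖ < κ → v ∈ HB 0 ρ := fun h1 h2 =>
    ⟨h1, by simpa using h2.trans_le hκρ⟩
  have hκ₀κ : κ₀ ≤ κ := min_le_left _ _
  have csub : ∀ {t}, t ∈ Ico (0:ℝ) 1 → ContinuousOn x (Icc 0 t) := fun ht =>
    cx.mono (fun s hs => ⟨hs.1, hs.2.trans_lt ht.2⟩)
  have hlo : ∀ t ∈ Ico (0:ℝ) 1, R' < ‖x t‖ := by
    intro t ht
    by_contra hcon
    push Not at hcon
    obtain ⟨s, hs, hxs⟩ := intermediate_value_Icc' ht.1 (csub ht).norm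
      ⟨hcon, by rw [x0]; exact hR'a.le⟩
    have hs' : s ∈ Ico (0:ℝ) 1 := ⟨hs.1, hs.2.trans_lt ht.2⟩
    simp only [] at hxs
    have h1 := xd s hs' (hHB (xim s hs') (by rw [hxs]; linarith))
    linarith [hRg' _ (xim s hs') hxs]
  have hhi : ∀ t ∈ Ico (0:ℝ) 1, ‖x t‖ < R := by
    intro t ht
    by_contra hcon
    push Not at hcon
    obtain ⟨s, hs, hxs⟩ := intermediate_value_Icc ht.1 (csub ht).norm
      ⟨by rw [x0]; linarith [hR.1], hcon⟩
    have hs' : s ∈ Ico (0:ℝ) 1 := ⟨hs.1, hs.2.trans_lt ht.2⟩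
    simp only [] at hxs
    have h1 := xd s hs' (hHB (xim s hs') (by rw [hxs]; linarith))
    linarith [hRg _ (xim s hs') hxs]
  have hΩ : ∀ t ∈ Ico (0:ℝ) 1, x t ∈ HB 0 ρ := fun t ht =>
    hHB (xim t ht) (by linarith [hhi t ht])
  have hre0 : ∀ t ∈ Ico (0:ℝ) 1, (x t).re ≠ 0 := by
    intro t ht h0
    have e : x t = ((x t).im : ℂ) * Complex.I := by
      apply Complex.ext <;> simp [h0]
    have hn : ‖x t‖ = (x t).im := by
      rw [e, norm_mul, Complex.norm_I, mul_one, Complex.norm_real, Real.norm_eq_abs,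
        abs_of_pos (xim t ht)]; simp
    have := hvert (x t).im (xim t ht) (by
      rw [← hn]; linarith [hhi t ht, min_le_right κ η])
    rw [← e] at this
    linarith [xd t ht (hΩ t ht)]
  have hσ0 : σ ≠ 0 := by rcases hσ with h | h <;> rw [h] <;> norm_num
  have hside : ∀ t ∈ Ico (0:ℝ) 1, 0 < σ * (x t).re := by
    intro t ht
    by_contra hcon
    push Not at hcon
    have cc : ContinuousOn (fun t => σ * (x t).re) (Icc 0 t) :=
      continuousOn_const.mul (Complex.continuous_re.comp_continuousOn (csub ht))
    obtain ⟨s, hs, hxs⟩ := intermediate_value_Icc' ht.1 cc ⟨hcon, by rw [x0]; exact hare⟩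
    have hs' : s ∈ Ico (0:ℝ) 1 := ⟨hs.1, hs.2.trans_lt ht.2⟩
    rcases mul_eq_zero.1 hxs with h | h
    · exact hσ0 h
    · exact hre0 s hs' h
  have hev : ∀ᶠ t in 𝓝[<] (1:ℝ), t ∈ Ico (0:ℝ) 1 :=
    Ico_mem_nhdsLT (by norm_num)
  -- cluster point
  obtain ⟨P, hPb, hP⟩ := (isCompact_closedBall (0:ℂ) R).exists_mapClusterPt (f := 𝓝[<] (1:ℝ)) (u := x)
    (tendsto_principal.2 (hev.mono fun t ht => by simpa using (hhi t ht).le))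
  have hcls : ∀ {S : Set ℂ}, IsClosed S → (∀ t ∈ Ico (0:ℝ) 1, x t ∈ S) → P ∈ S := by
    intro S hS h
    by_contra hPS
    have h1 := hP.frequently (hS.isOpen_compl.mem_nhds hPS)
    obtain ⟨t, ht, ht'⟩ := (h1.and_eventually hev).exists
    exact ht (h t ht')
  have hPim : P.im = 0 := by
    have h1 : 0 ≤ P.im := hcls (S := {v : ℂ | 0 ≤ v.im}) (isClosed_le continuous_const Complex.continuous_im)
      (fun t ht => (xim t ht).le)
    by_contra hne
    exact xcl P (lt_of_le_of_ne h1 (Ne.symm hne)) hP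
  have hPside : 0 ≤ σ * P.re := hcls (S := {v : ℂ | 0 ≤ σ * v.re})
    (isClosed_le continuous_const (continuous_const.mul Complex.continuous_re)) (fun t ht => (hside t ht).le)
  have hPlo : R' ≤ ‖P‖ := hcls (S := {v : ℂ | R' ≤ ‖v‖}) (isClosed_le continuous_const continuous_norm)
    (fun t ht => (hlo t ht).le)
  have hPhi : ‖P‖ ≤ R := by simpa using hPb
  obtain ⟨P', rfl⟩ : ∃ P' : ℝ, P = P' := ⟨P.re, Complex.ext rfl (by simpa using hPim)⟩
  simp only [Complex.ofReal_re] at hPside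
  rw [Complex.norm_real, Real.norm_eq_abs] at hPlo hPhi
  have habsσ : |P'| = σ * P' := by
    have h1 : |σ * P'| = |P'| := by
      rw [abs_mul]; rcases hσ with h | h <;> rw [h] <;> simp
    rw [← h1, abs_of_nonneg hPside]
  -- crosscut at P'
  set d := dist (f a) z with hd
  have hη₀ : 0 < κ - |P'| := by linarith
  have hsubP : HB P' (κ - |P'|) ⊆ HB 0 ρ := by
    rintro v ⟨h1, h2⟩
    refine hHB h1 ?_
    rw [mem_ball, dist_eq_norm] at h2
    have : ‖v‖ ≤ ‖v - P'‖ + ‖(P':ℂ)‖ := by simpa using norm_add_le (v - P') P'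
    rw [Complex.norm_real, Real.norm_eq_abs] at this
    linarith
  obtain ⟨η', hη', hsc⟩ := scale_semi hf hinj hvol hη₀ hsubP (ε := (δ - d) / 2) (by linarith)
  have haP : 0 < dist a P' := dist_pos.2 (fun h => by have := ha.1; simp [h] at this)
  set m := min (min η' (κ - |P'|)) (min |P'| (dist a P')) with hm
  have hm0 : 0 < m := by
    have : 0 < |P'| := by linarith
    positivity
  have m1 : m ≤ η' := (min_le_left _ _).trans (min_le_left _ _)
  have m2 : m ≤ κ - |P'| := (min_le_left _ _).trans (min_le_right _ _)
  have m3 : m ≤ |P'| := (min_le_right _ _).trans (min_le_left _ _)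
  have m4 : m ≤ dist a P' := (min_le_right _ _).trans (min_le_right _ _)
  obtain ⟨r, hr, hrd⟩ := hsc (m / 2) (by positivity) (by linarith)
  have hr0 : 0 < r := by linarith [hr.1]
  have hrm : r < m := by linarith [hr.2]
  -- x meets circle
  obtain ⟨t1, ht1r, ht1⟩ := ((hP.frequently (ball_mem_nhds (P':ℂ) hr0)).and_eventually hev).exists
  have cc : ContinuousOn (fun t => dist (x t) P') (Icc 0 t1) :=
    (continuous_id.dist continuous_const).comp_continuousOn (csub ht1)
  obtain ⟨s, hs, hxs⟩ := intermediate_value_Icc' ht1.1 cc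
    ⟨(mem_ball.1 ht1r).le, by rw [x0]; linarith⟩
  simp only [] at hxs
  have hs' : s ∈ Ico (0:ℝ) 1 := ⟨hs.1, hs.2.trans_lt ht1.2⟩
  refine ⟨P' + r, ?_, ?_, ?_⟩
  · rw [mul_add]
    rcases hσ with h | h
    · rw [← habsσ, h]; linarith
    · rw [← habsσ, h]; linarith
  · calc |P' + r| ≤ |P'| + |r| := abs_add_le _ _
      _ < κ := by rw [abs_of_pos hr0]; linarith
  · set S := ({v | v ∈ HB 0 ρ ∧ f v ∈ ball z δ} ∪ {((P' + r : ℝ) : ℂ)}) with hS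
    have j1 : JoinedIn S a (x s) := by
      have hpc := ((convex_Icc (0:ℝ) s).isPathConnected (nonempty_Icc.2 hs.1)).image' (csub hs')
      refine (hpc.joinedIn a ⟨0, left_mem_Icc.2 hs.1, x0⟩ (x s) ⟨s, right_mem_Icc.2 hs.1, rfl⟩).mono ?_
      rintro _ ⟨t, ht, rfl⟩
      have ht' : t ∈ Ico (0:ℝ) 1 := ⟨ht.1, ht.2.trans_lt hs'.2⟩
      exact Or.inl ⟨hΩ t ht', mem_ball.2 ((xd t ht' (hΩ t ht')).trans_lt had)⟩
    refine j1.trans ?_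
    set θ := Complex.arg (x s - P') with hθ
    have him : 0 < (x s - P').im := by simpa using xim s hs'
    have hθ0 : 0 ≤ θ := Complex.arg_nonneg_iff.2 him.le
    have hθπ : θ < Real.pi := by
      refine lt_of_le_of_ne (Complex.arg_le_pi _) ?_
      intro h
      rw [Complex.arg_eq_pi_iff] at h
      exact him.ne' h.2
    have hrep := polar_repr P' (x s)
    rw [hxs] at hrep
    let γ : ℝ → ℂ := fun u => P' + r * Complex.exp (u * Complex.I)
    have cγ : Continuous γ := by fun_prop
    have hpc := ((convex_Icc (0:ℝ) θ).isPathConnected (nonempty_Icc.2 hθ0)).image' cγ.continuousOn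
    refine (hpc.joinedIn (x s) ⟨θ, right_mem_Icc.2 hθ0, hrep⟩ ((P' + r : ℝ) : ℂ)
      ⟨0, left_mem_Icc.2 hθ0, by simp [γ]⟩).mono ?_
    rintro _ ⟨u, hu, rfl⟩
    rcases hu.1.eq_or_lt with h0 | h0
    · right; subst h0; simp [γ]
    · left
      have hd' : dist (γ u) P' = r := by
        simp [γ, abs_of_pos hr0, Complex.norm_exp_ofReal_mul_I]
      have hγim : 0 < (γ u).im := by
        simp only [γ, Complex.exp_mul_I]
        rw [← Complex.ofReal_cos, ← Complex.ofReal_sin]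
        simp
        exact mul_pos hr0 (Real.sin_pos_of_mem_Ioo ⟨h0, hu.2.trans_lt hθπ⟩)
      refine ⟨hsubP ⟨hγim, by rw [mem_ball, hd']; linarith⟩, ?_⟩
      have k1 := hrd (γ u) (x s) hγim (xim s hs') hd' hxs
      have k2 := xd s hs' (hΩ s hs')
      rw [mem_ball]
      linarith [dist_triangle (f (γ u)) (f (x s)) z]

open Filter Topology Metric Set OnePoint

lemma piece {p : ℝ → ℂ} {T : ℝ} (hp : ContinuousOn p (Ici T)) {t1 t2 : ℝ} (h1 : T ≤ t1)
    (h2 : T ≤ t2) : ∃ g : ℝ → ℂ, Continuous g ∧ g 0 = p t1 ∧ g 1 = p t2 ∧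
      ∀ s, ∃ t, T ≤ t ∧ g s = p t := by
  have hm : ∀ s : ℝ, T ≤ t1 + (projIcc (0:ℝ) 1 zero_le_one s : ℝ) * (t2 - t1) := by
    intro s
    have := (projIcc (0:ℝ) 1 zero_le_one s).2
    nlinarith [this.1, this.2]
  refine ⟨fun s => p (t1 + (projIcc (0:ℝ) 1 zero_le_one s : ℝ) * (t2 - t1)), ?_, ?_, ?_, ?_⟩
  · refine hp.comp_continuous ?_ hm
    have : Continuous (fun s : ℝ => (projIcc (0:ℝ) 1 zero_le_one s : ℝ)) :=
      continuous_subtype_val.comp continuous_projIcc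
    fun_prop
  · simp
  · simp
  · exact fun s => ⟨_, hm s, rfl⟩

def Reach (f : ℂ → ℂ) (ρ : ℝ) (z : ℂ) : Prop :=
  ∀ a ∈ HB 0 ρ, ∃ x : ℝ → ℂ, ContinuousOn x (Ico 0 1) ∧ x 0 = a ∧
      (∀ t ∈ Ico (0:ℝ) 1, 0 < (x t).im) ∧
      (∀ t ∈ Ico (0:ℝ) 1, x t ∈ HB 0 ρ → dist (f (x t)) z ≤ dist (f a) z) ∧
      (∀ P : ℂ, 0 < P.im → ¬ MapClusterPt P (𝓝[<] 1) x)

open MeasureTheory in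
lemma pick {f : ℂ → ℂ} {ρ : ℝ} (hρ : 0 < ρ) (hf : DifferentiableOn ℂ f (HB 0 ρ))
    (hinj : InjOn f (HB 0 ρ)) (hvol : volume (f '' (HB 0 ρ)) ≠ ⊤) {z : ℂ} {σ : ℝ}
    (hσ : σ = 1 ∨ σ = -1) {a : ℕ → ℂ} (ha0 : Tendsto a atTop (𝓝 0))
    (ha : ∀ j, 0 < (a j).im ∧ 0 ≤ σ * (a j).re) (haz : Tendsto (fun j => f (a j)) atTop (𝓝 z))
    {p q : ℝ → ℂ} (hp : ContinuousOn p (Ici 0)) (hpim : ∀ t, 0 ≤ t → 0 < (p t).im)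
    (hpa : ∀ j, ∃ t, 0 ≤ t ∧ p t = a j)
    {T : ℝ} (hT : 0 ≤ T) (hq : ContinuousOn q (Ici 0)) (hq0 : Tendsto q atTop (𝓝 0))
    (hqΩ : ∀ t, T ≤ t → q t ∈ HB 0 ρ) {ε : ℝ} (hε : 0 < ε)
    (hqz : ∀ t, T ≤ t → 2 * ε ≤ dist (f (q t)) z)
    (hreach : Reach f ρ z) {κ : ℝ} (hκ : 0 < κ) :
    ∃ t, T ≤ t ∧ ∃ P : ℝ, 0 < σ * P ∧ |P| < κ ∧
        JoinedIn ({v | v ∈ HB 0 ρ ∧ f v ∈ ball z ε} ∪ {(P : ℂ)}) (p t) P := by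
  obtain ⟨η, hη, hv, hg⟩ := avoid hρ hf hinj hvol (hq.mono (Ici_subset_Ici.2 hT)) hqΩ hq0
    (by positivity : 0 < 2 * ε) hqz
  have he : 2 * ε / 2 = ε := by ring
  rw [he] at hv hg
  obtain ⟨κ', hκ', hl⟩ := landing hf hinj hvol hη hv hg hreach hσ
    (lt_min hκ hρ) (min_le_right κ ρ)
  obtain ⟨m, hm, hmp⟩ : ∃ m, 0 < m ∧ ∀ t ∈ Icc 0 T, m ≤ ‖p t‖ := by
    have hc : ContinuousOn (fun t => ‖p t‖) (Icc 0 T) := (hp.mono Icc_subset_Ici_self).norm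
    obtain ⟨t, ht, hmin⟩ := isCompact_Icc.exists_isMinOn (nonempty_Icc.2 hT) hc
    refine ⟨‖p t‖, norm_pos_iff.2 (fun h => ?_), fun s hs => hmin hs⟩
    have := hpim t ht.1
    simp [h] at this
  have hn := ha0.norm
  rw [norm_zero] at hn
  obtain ⟨j, ⟨⟨h1, h2⟩, h3⟩, h4⟩ := (((hn.eventually (gt_mem_nhds hκ')).and
    (hn.eventually (gt_mem_nhds hρ))).and (hn.eventually (gt_mem_nhds hm))).and
    (haz.eventually (ball_mem_nhds z hε)) |>.exists
  obtain ⟨t, ht, hta⟩ := hpa j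
  obtain ⟨P, hP1, hP2, hP3⟩ := hl (a j) ⟨(ha j).1, by simpa using h2⟩ h1 (ha j).2 h4
  refine ⟨t, ?_, P, hP1, hP2.trans_le (min_le_left _ _), by rwa [hta]⟩
  by_contra hcon
  push Not at hcon
  have := hmp t ⟨ht, hcon.le⟩
  rw [hta] at this
  linarith

open MeasureTheory in
lemma core {f : ℂ → ℂ} {ρ : ℝ} (hρ : 0 < ρ) (hf : DifferentiableOn ℂ f (HB 0 ρ))
    (hinj : InjOn f (HB 0 ρ)) (hvol : volume (f '' (HB 0 ρ)) ≠ ⊤) {z w : ℂ} (hzw : z ≠ w)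
    {σ : ℝ} (hσ : σ = 1 ∨ σ = -1) {a b : ℕ → ℂ} (ha0 : Tendsto a atTop (𝓝 0))
    (hb0 : Tendsto b atTop (𝓝 0))
    (ha : ∀ j, 0 < (a j).im ∧ 0 ≤ σ * (a j).re) (haz : Tendsto (fun j => f (a j)) atTop (𝓝 z))
    (hb : ∀ j, 0 < (b j).im ∧ 0 ≤ σ * (b j).re) (hbw : Tendsto (fun j => f (b j)) atTop (𝓝 w))
    {p q : ℝ → ℂ} (hp : ContinuousOn p (Ici 0)) (hpim : ∀ t, 0 ≤ t → 0 < (p t).im)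
    (hp0 : Tendsto p atTop (𝓝 0))
    (hpa : ∀ j, ∃ t, 0 ≤ t ∧ p t = a j)
    (hq : ContinuousOn q (Ici 0)) (hqim : ∀ t, 0 ≤ t → 0 < (q t).im)
    (hq0 : Tendsto q atTop (𝓝 0))
    (hqb : ∀ j, ∃ t, 0 ≤ t ∧ q t = b j)
    (hpw : ∃ δ > 0, ∀ᶠ t in atTop, δ ≤ dist (f (p t)) w)
    (hqz : ∃ δ > 0, ∀ᶠ t in atTop, δ ≤ dist (f (q t)) z)
    (hrz : Reach f ρ z) (hrw : Reach f ρ w) : False := by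
  obtain ⟨δ₁, hδ₁, h1⟩ := hpw
  obtain ⟨δ₂, hδ₂, h2⟩ := hqz
  have hd := dist_pos.2 hzw
  set ε := min (min δ₁ δ₂) (dist z w) / 2 with hεd
  have hε : 0 < ε := by positivity
  have e1 : 2 * ε ≤ δ₁ := by
    have : 2 * ε = min (min δ₁ δ₂) (dist z w) := by rw [hεd]; ring
    rw [this]; exact (min_le_left _ _).trans (min_le_left _ _)
  have e2 : 2 * ε ≤ δ₂ := by
    have : 2 * ε = min (min δ₁ δ₂) (dist z w) := by rw [hεd]; ring
    rw [this]; exact (min_le_left _ _).trans (min_le_right _ _)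
  have e3 : 2 * ε ≤ dist z w := by
    have : 2 * ε = min (min δ₁ δ₂) (dist z w) := by rw [hεd]; ring
    rw [this]; exact min_le_right _ _
  have hall := (((h1.and h2).and (hp0.eventually (ball_mem_nhds 0 hρ))).and
    (hq0.eventually (ball_mem_nhds 0 hρ))).and (eventually_ge_atTop 0)
  obtain ⟨T, hT⟩ := eventually_atTop.1 hall
  have hT0 : 0 ≤ T := (hT T le_rfl).2
  have hpΩ : ∀ t, T ≤ t → p t ∈ HB 0 ρ := fun t ht =>
    ⟨hpim t (hT0.trans ht), by simpa using (hT t ht).1.1.2⟩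
  have hqΩ : ∀ t, T ≤ t → q t ∈ HB 0 ρ := fun t ht =>
    ⟨hqim t (hT0.trans ht), by simpa using (hT t ht).1.2⟩
  have hpw : ∀ t, T ≤ t → 2 * ε ≤ dist (f (p t)) w := fun t ht => e1.trans (hT t ht).1.1.1.1
  have hqz : ∀ t, T ≤ t → 2 * ε ≤ dist (f (q t)) z := fun t ht => e2.trans (hT t ht).1.1.1.2
  have A := fun {κ : ℝ} (hκ : 0 < κ) => pick hρ hf hinj hvol hσ ha0 ha haz hp hpim hpa hT0 hq hq0 hqΩ
    hε hqz hrz hκ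
  have B := fun {κ : ℝ} (hκ : 0 < κ) => pick hρ hf hinj hvol hσ hb0 hb hbw hq hqim hqb hT0 hp hp0 hpΩ
    hε hpw hrw hκ
  have nz : ∀ {x : ℝ}, 0 < σ * x → 0 < |x| := fun h => abs_pos.2 (fun h0 => by simp [h0] at h)
  obtain ⟨t1, ht1, P1, hP1, -, l1⟩ := A one_pos
  obtain ⟨s1, hs1, Q1, hQ1, k1, m1⟩ := B (nz hP1)
  obtain ⟨t2, ht2, P2, hP2, k2, l2⟩ := A (nz hQ1)
  obtain ⟨s2, hs2, Q2, hQ2, k3, m2⟩ := B (nz hP2)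
  have hdis : Disjoint (ball z ε) (ball w ε) := ball_disjoint_ball (by linarith)
  have hpT := hp.mono (Ici_subset_Ici.2 hT0)
  have hqT := hq.mono (Ici_subset_Ici.2 hT0)
  have him : ∀ v ∈ HB 0 ρ, 0 < v.im := fun v hv => hv.1
  rcases hσ with h | h
  · rw [h, one_mul] at hP1 hP2 hQ1 hQ2
    rw [abs_of_pos hP1, abs_of_pos hQ1] at k1
    rw [abs_of_pos hP2, abs_of_pos hQ1] at k2
    rw [abs_of_pos hP2, abs_of_pos hQ2] at k3
    obtain ⟨g, cg, g0, g1, hg⟩ := piece hpT ht2 ht1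
    obtain ⟨k, ck, k0, k1', hk⟩ := piece hqT hs2 hs1
    refine no_interleave (HB_open _ _) (HB_convex _ _) hf hinj him (convex_ball w ε)
      (convex_ball z ε) hdis.symm ck cg ?_ ?_ ?_ ?_ k3 k2 k1 (k0 ▸ m2) (k1' ▸ m1) (g0 ▸ l2) (g1 ▸ l1)
    · intro s; obtain ⟨t, ht, e⟩ := hk s; rw [e]; exact hqΩ t ht
    · intro s; obtain ⟨t, ht, e⟩ := hg s; rw [e]; exact hpΩ t ht
    · intro s hs; obtain ⟨t, ht, e⟩ := hk s; rw [e] at hs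
      have := hqz t ht; rw [mem_ball] at hs; linarith
    · intro s hs; obtain ⟨t, ht, e⟩ := hg s; rw [e] at hs
      have := hpw t ht; rw [mem_ball] at hs; linarith
  · rw [h] at hP1 hP2 hQ1 hQ2
    rw [abs_of_neg (by linarith : P1 < 0), abs_of_neg (by linarith : Q1 < 0)] at k1
    rw [abs_of_neg (by linarith : P2 < 0), abs_of_neg (by linarith : Q1 < 0)] at k2
    rw [abs_of_neg (by linarith : P2 < 0), abs_of_neg (by linarith : Q2 < 0)] at k3
    obtain ⟨g, cg, g0, g1, hg⟩ := piece hpT ht1 ht2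
    obtain ⟨k, ck, k0, k1', hk⟩ := piece hqT hs1 hs2
    refine no_interleave (HB_open _ _) (HB_convex _ _) hf hinj him (convex_ball z ε)
      (convex_ball w ε) hdis cg ck ?_ ?_ ?_ ?_ (by linarith) (by linarith) (by linarith)
      (g0 ▸ l1) (g1 ▸ l2) (k0 ▸ m1) (k1' ▸ m2)
    · intro s; obtain ⟨t, ht, e⟩ := hg s; rw [e]; exact hpΩ t ht
    · intro s; obtain ⟨t, ht, e⟩ := hk s; rw [e]; exact hqΩ t ht
    · intro s hs; obtain ⟨t, ht, e⟩ := hg s; rw [e] at hs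
      have := hpw t ht; rw [mem_ball] at hs; linarith
    · intro s hs; obtain ⟨t, ht, e⟩ := hk s; rw [e] at hs
      have := hqz t ht; rw [mem_ball] at hs; linarith

/-- Cayley transform -/
def cay (ζ x : ℂ) : ℂ := Complex.I * (1 - x / ζ) / (1 + x / ζ)

def cayInv (ζ v : ℂ) : ℂ := ζ * ((1 + Complex.I * v) / (1 - Complex.I * v))

def toC (x : ℂ∞) : ℂ := x.elim 0 id

lemma toC_coe (c : ℂ) : toC (c : ℂ∞) = c := rfl

lemma coe_toC {x : ℂ∞} (h : x ≠ ∞) : ((toC x : ℂ) : ℂ∞) = x := by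
  obtain ⟨c, rfl⟩ := OnePoint.ne_infty_iff_exists.1 h
  rfl

lemma den1 {u : ℂ} (h : ‖u‖ < 1) : 1 + u ≠ 0 := by
  intro h0
  have : u = -1 := by linear_combination h0
  rw [this] at h; simp at h

lemma den2 {v : ℂ} (h : -1 < v.im) : 1 - Complex.I * v ≠ 0 := by
  intro h0
  have := congrArg Complex.re h0
  simp at this
  linarith

lemma div_norm {ζ x : ℂ} (hζ : ‖ζ‖ = 1) : ‖x / ζ‖ = ‖x‖ := by simp [hζ]

lemma cay_aux (u : ℂ) : (Complex.I * (1 - u) / (1 + u)).im = (1 - Complex.normSq u) / Complex.normSq (1 + u)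
   ∧ (Complex.I * (1 - u) / (1 + u)).re = 2 * u.im / Complex.normSq (1 + u) := by
  constructor
  · rw [Complex.div_im, ← sub_div]
    congr 1
    simp [Complex.normSq_apply]; ring
  · rw [Complex.div_re, ← add_div]
    congr 1
    simp; ring

lemma cay_im {ζ x : ℂ} (hζ : ‖ζ‖ = 1) (hx : ‖x‖ < 1) : 0 < (cay ζ x).im := by
  have hu : ‖x / ζ‖ < 1 := by rwa [div_norm hζ]
  rw [cay, (cay_aux _).1]
  refine div_pos ?_ (Complex.normSq_pos.2 (den1 hu))
  rw [Complex.normSq_eq_norm_sq]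
  nlinarith [norm_nonneg (x / ζ)]

lemma cay_re {ζ x : ℂ} {s : ℝ} (h : 0 ≤ s * (x / ζ).im) : 0 ≤ s * (cay ζ x).re := by
  rw [cay, (cay_aux _).2]
  have : s * (2 * (x / ζ).im / Complex.normSq (1 + x / ζ)) =
    2 * (s * (x / ζ).im) / Complex.normSq (1 + x / ζ) := by ring
  rw [this]
  exact div_nonneg (by linarith) (Complex.normSq_nonneg _)

lemma cayInv_mem {ζ v : ℂ} (hζ : ‖ζ‖ = 1) (hv : 0 < v.im) : cayInv ζ v ∈ ball (0:ℂ) 1 := by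
  rw [mem_ball_zero_iff, cayInv, norm_mul, hζ, one_mul, norm_div,
    div_lt_one (norm_pos_iff.2 (den2 (by linarith)))]
  rw [← sq_lt_sq₀ (norm_nonneg _) (norm_nonneg _), ← Complex.normSq_eq_norm_sq,
    ← Complex.normSq_eq_norm_sq]
  simp [Complex.normSq_apply]
  nlinarith

lemma cayInv_cay {ζ x : ℂ} (hζ : ‖ζ‖ = 1) (hx : ‖x‖ < 1) : cayInv ζ (cay ζ x) = x := by
  have hz : ζ ≠ 0 := norm_pos_iff.1 (by rw [hζ]; exact one_pos)
  have hu : 1 + x / ζ ≠ 0 := den1 (by rwa [div_norm hζ])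
  have h2 := den2 (v := cay ζ x) (by linarith [cay_im hζ hx])
  have e : x = ζ * (x / ζ) := by field_simp
  have key : (1 + Complex.I * cay ζ x) = (x / ζ) * (1 - Complex.I * cay ζ x) := by
    have : cay ζ x * (1 + x / ζ) = Complex.I * (1 - x / ζ) := by
      rw [cay]; exact div_mul_cancel₀ _ hu
    linear_combination Complex.I * this + (1 - x / ζ) * Complex.I_mul_I
  rw [cayInv, key, mul_div_cancel_right₀ _ h2]
  exact e.symm

lemma cay_cayInv {ζ v : ℂ} (hζ : ‖ζ‖ = 1) (hv : 0 < v.im) : cay ζ (cayInv ζ v) = v := by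
  have hz : ζ ≠ 0 := norm_pos_iff.1 (by rw [hζ]; exact one_pos)
  have h2 := den2 (v := v) (by linarith)
  have e : cayInv ζ v / ζ = (1 + Complex.I * v) / (1 - Complex.I * v) := by
    rw [cayInv, mul_div_cancel_left₀ _ hz]
  have h1 : 1 + (1 + Complex.I * v) / (1 - Complex.I * v) = 2 / (1 - Complex.I * v) := by
    field_simp; ring
  have h3 : 1 - (1 + Complex.I * v) / (1 - Complex.I * v) = -2 * (Complex.I * v) / (1 - Complex.I * v) := by
    field_simp; ring
  rw [cay, e, h1, h3, mul_div_assoc', div_div_div_cancel_right₀ h2]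
  linear_combination -v * Complex.I_mul_I

lemma cay_cont {ζ : ℂ} (hζ : ‖ζ‖ = 1) : ContinuousOn (cay ζ) (ball 0 1) := by
  unfold cay
  refine ContinuousOn.div (by fun_prop) (by fun_prop) (fun x hx => den1 ?_)
  rw [div_norm hζ]; simpa using hx

lemma cay_tend {ζ : ℂ} (hζ : ‖ζ‖ = 1) : Tendsto (cay ζ) (𝓝 ζ) (𝓝 0) := by
  have hz : ζ ≠ 0 := norm_pos_iff.1 (by rw [hζ]; exact one_pos)
  have : ContinuousAt (cay ζ) ζ := by
    unfold cay
    refine ContinuousAt.div (by fun_prop) (by fun_prop) ?_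
    rw [div_self hz]; norm_num
  have h := this.tendsto
  rwa [show cay ζ ζ = 0 by simp [cay, div_self hz]] at h

lemma cayInv_diff {ζ v : ℂ} (hv : -1 < v.im) : DifferentiableAt ℂ (cayInv ζ) v := by
  unfold cayInv
  have := den2 hv
  fun_prop (disch := assumption)

lemma cayInv_tend {ζ : ℂ} : Tendsto (cayInv ζ) (𝓝 0) (𝓝 ζ) := by
  have h := (cayInv_diff (ζ := ζ) (v := 0) (by simp)).continuousAt.tendsto
  rwa [show cayInv ζ 0 = ζ by simp [cayInv]] at h

lemma toC_diff {φ : ℂ → ℂ∞} {D : Set ℂ} (h : HolomorphicIntoSphereOn φ D) {x : ℂ} (hx : x ∈ D)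
    (hfin : φ x ≠ ∞) : DifferentiableAt ℂ (fun x => toC (φ x)) x := by
  rcases h x hx with ⟨g, hg, he⟩ | ⟨g, hg, he⟩
  · refine hg.differentiableAt.congr_of_eventuallyEq ?_
    filter_upwards [he] with y hy
    rw [hy, toC_coe]
  · have h0 : g x ≠ 0 := by
      intro h0
      have := he.self_of_nhds
      rw [if_pos h0] at this
      exact hfin this
    refine (hg.differentiableAt.inv h0).congr_of_eventuallyEq ?_
    filter_upwards [he, hg.continuousAt.eventually_ne h0] with y hy hy0
    rw [hy, if_neg hy0, toC_coe]; rfl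

lemma toC_tend {α : Type*} {l : Filter α} {g : α → ℂ∞} {z : ℂ} (h : Tendsto g l (𝓝 (z : ℂ∞))) :
    Tendsto (fun t => toC (g t)) l (𝓝 z) := by
  have : ContinuousAt toC (z : ℂ∞) := by
    rw [OnePoint.continuousAt_coe]
    exact continuousAt_id
  exact this.tendsto.comp h

lemma bdd_near {U : Set ℂ∞} (hU : IsOpen U) (hinf : ∞ ∈ U) {φ : ℂ → ℂ∞} {ψ : ℂ∞ → ℂ}
    (hψcont : ContinuousOn ψ U) (hψmaps : MapsTo ψ U (ball (0 : ℂ) 1))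
    (hψφ : ∀ z ∈ ball (0 : ℂ) 1, ψ (φ z) = z) {ζ : ℂ} (hζ : ‖ζ‖ = 1) :
    ∃ R ρ : ℝ, 0 < ρ ∧ ∀ v ∈ HB 0 ρ, φ (cayInv ζ v) ≠ ∞ ∧ ‖toC (φ (cayInv ζ v))‖ ≤ R := by
  obtain ⟨N, hN, hNU, hNc⟩ := local_compact_nhds (hU.mem_nhds hinf)
  have hc : IsCompact (ψ '' N) := hNc.image_of_continuousOn (hψcont.mono hNU)
  have hζN : ζ ∈ (ψ '' N)ᶜ := by
    rintro ⟨y, hy, hyζ⟩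
    have := hψmaps (hNU hy)
    rw [hyζ, mem_ball_zero_iff, hζ] at this
    exact lt_irrefl _ this
  have hnear := (cayInv_tend (ζ := ζ)).eventually (hc.isClosed.isOpen_compl.mem_nhds hζN)
  obtain ⟨ρ, hρ, hball⟩ := Metric.eventually_nhds_iff_ball.1 hnear
  have hbd : ∃ R : ℝ, ∀ c : ℂ, (c : ℂ∞) ∉ N → ‖c‖ ≤ R := by
    have h1 : ∀ᶠ c : ℂ in coclosedCompact ℂ, (c : ℂ∞) ∈ N := OnePoint.tendsto_coe_infty.eventually hN
    rw [coclosedCompact_eq_cocompact, ← Metric.cobounded_eq_cocompact] at h1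
    have h2 : Bornology.IsBounded {c : ℂ | (c : ℂ∞) ∉ N} := by
      rw [Bornology.isBounded_def]
      filter_upwards [h1] with c hc
      simpa using hc
    obtain ⟨R, hR⟩ := isBounded_iff_forall_norm_le.1 h2
    exact ⟨R, fun c hc => hR c hc⟩
  obtain ⟨R, hR⟩ := hbd
  refine ⟨R, ρ, hρ, fun v hv => ?_⟩
  have hx := cayInv_mem hζ hv.1
  have hnN : φ (cayInv ζ v) ∉ N := fun h => hball v (by simpa using hv.2) ⟨_, h, hψφ _ hx⟩
  have hne : φ (cayInv ζ v) ≠ ∞ := fun h => hnN (h ▸ mem_of_mem_nhds hN)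
  exact ⟨hne, hR _ (by rwa [coe_toC hne])⟩

lemma not_mem_U {U : Set ℂ∞} (hU : IsOpen U) {ψ : ℂ∞ → ℂ}
    (hψcont : ContinuousOn ψ U) (hψmaps : MapsTo ψ U (ball (0 : ℂ) 1)) {ζ : ℂ} (hζ : ‖ζ‖ = 1)
    {α : ℕ → ℂ∞} {z : ℂ∞} (h1 : Tendsto (fun j => ψ (α j)) atTop (𝓝 ζ))
    (h2 : Tendsto α atTop (𝓝 z)) : z ∉ U := by
  intro hz
  have := ((hψcont.continuousAt (hU.mem_nhds hz)).tendsto.comp h2)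
  have e := tendsto_nhds_unique h1 this
  have := hψmaps hz
  rw [← e, mem_ball_zero_iff, hζ] at this
  exact lt_irrefl _ this

lemma tail_avoid {Γ : ℝ → ℂ∞} {w : ℂ} (h : (w : ℂ∞) ∉ accSet Γ) (hfin : ∀ᶠ t in atTop, Γ t ≠ ∞) :
    ∃ δ > 0, ∀ᶠ t in atTop, δ ≤ dist (toC (Γ t)) w := by
  by_contra hcon
  push Not at hcon
  apply h
  have hx : ∀ n : ℕ, ∃ t : ℝ, (n:ℝ) ≤ t ∧ Γ t ≠ ∞ ∧ dist (toC (Γ t)) w < 1 / ((n:ℝ) + 1) := by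
    intro n
    have hf := hcon (1 / ((n:ℝ) + 1)) (by positivity)
    obtain ⟨t, ht, h1, h2⟩ := (hf.and_eventually (hfin.and (eventually_ge_atTop (n:ℝ)))).exists
    exact ⟨t, h2, h1, ht⟩
  choose t h1 h2 h3 using hx
  refine ⟨t, tendsto_atTop_mono h1 tendsto_natCast_atTop_atTop, ?_⟩
  have : Tendsto (fun n => toC (Γ (t n))) atTop (𝓝 w) := by
    rw [tendsto_iff_dist_tendsto_zero]
    exact squeeze_zero (fun _ => dist_nonneg) (fun n => (h3 n).le) tendsto_one_div_add_atTop_nhds_zero_nat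
  have h4 := (OnePoint.continuous_coe.tendsto w).comp this
  refine h4.congr (fun n => ?_)
  exact coe_toC (h2 n)

lemma reach_of {U : Set ℂ∞} (hU : IsOpen U) {φ : ℂ → ℂ∞} {ψ : ℂ∞ → ℂ}
    (hφcont : ContinuousOn φ (ball (0 : ℂ) 1))
    (hφmaps : MapsTo φ (ball (0 : ℂ) 1) U)
    (hψcont : ContinuousOn ψ U) (hψmaps : MapsTo ψ U (ball (0 : ℂ) 1))
    (hψφ : ∀ z ∈ ball (0 : ℂ) 1, ψ (φ z) = z)
    (hφψ : ∀ w ∈ U, φ (ψ w) = w) {ζ : ℂ} (hζ : ‖ζ‖ = 1) {ρ : ℝ}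
    (hfin : ∀ v ∈ HB 0 ρ, φ (cayInv ζ v) ≠ ∞) {z : ℂ} (hz : (z : ℂ∞) ∉ U) :
    Reach (fun v => toC (φ (cayInv ζ v))) ρ z := by
  intro a ha
  set c := toC (φ (cayInv ζ a)) with hc
  have hcφ : (c : ℂ∞) = φ (cayInv ζ a) := coe_toC (hfin a ha)
  have hcU : (c : ℂ∞) ∈ U := by rw [hcφ]; exact hφmaps (cayInv_mem hζ ha.1)
  set seg : ℝ → ℂ := fun s => c + s * (z - c) with hseg
  have csegC : Continuous seg := by rw [hseg]; fun_prop
  have cseg : Continuous (fun s => (seg s : ℂ∞)) := OnePoint.continuous_coe.comp csegC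
  set S : Set ℝ := Icc 0 1 ∩ (fun s => (seg s : ℂ∞)) ⁻¹' Uᶜ with hS
  have hSc : IsCompact S := isCompact_Icc.inter_right (hU.isClosed_compl.preimage cseg)
  have hSne : S.Nonempty := ⟨1, by simp, by
    simp only [mem_preimage, mem_compl_iff, hseg]
    have : c + ((1:ℝ):ℂ) * (z - c) = z := by push_cast; ring
    rw [this]; exact hz⟩
  set τ := sInf S with hτ
  have hτS : τ ∈ S := hSc.sInf_mem hSne
  have hlow : ∀ s, 0 ≤ s → s < τ → (seg s : ℂ∞) ∈ U := by
    intro s hs0 hs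
    by_contra hcon
    exact absurd (csInf_le hSc.bddBelow (⟨⟨hs0, hs.le.trans hτS.1.2⟩, hcon⟩ : s ∈ S)) (not_le.2 hs)
  have hτ0 : 0 < τ := by
    rcases hτS.1.1.lt_or_eq with h | h
    · exact h
    · exfalso
      have := hτS.2
      rw [← h] at this
      apply this
      simp only [hseg]
      simpa using hcU
  have hin : ∀ t ∈ Ico (0:ℝ) 1, (seg (τ * t) : ℂ∞) ∈ U := fun t ht =>
    hlow _ (mul_nonneg hτ0.le ht.1) (by nlinarith [ht.2])
  have hb : ∀ t ∈ Ico (0:ℝ) 1, ‖ψ (seg (τ * t) : ℂ∞)‖ < 1 := fun t ht => by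
    simpa using hψmaps (hin t ht)
  have hback : ∀ t ∈ Ico (0:ℝ) 1, φ (cayInv ζ (cay ζ (ψ (seg (τ * t) : ℂ∞)))) = seg (τ * t) :=
    fun t ht => by rw [cayInv_cay hζ (hb t ht), hφψ _ (hin t ht)]
  refine ⟨fun t => cay ζ (ψ (seg (τ * t) : ℂ∞)), ?_, ?_, ?_, ?_, ?_⟩
  · refine (cay_cont hζ).comp (hψcont.comp ?_ hin) (fun t ht => hψmaps (hin t ht))
    exact (cseg.comp (continuous_const.mul continuous_id)).continuousOn
  · have : seg (τ * 0) = c := by simp [hseg]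
    simp only [this]
    rw [hcφ, hψφ _ (cayInv_mem hζ ha.1), cay_cayInv hζ ha.1]
  · exact fun t ht => cay_im hζ (hb t ht)
  · intro t ht _
    simp only []
    rw [hback t ht, toC_coe, ← hc]
    have e : seg (τ * t) - z = ((1 - τ * t : ℝ) : ℂ) * (c - z) := by
      simp only [hseg]; push_cast; ring
    rw [dist_eq_norm, dist_eq_norm, e, norm_mul, Complex.norm_real, Real.norm_eq_abs]
    have h1 : |1 - τ * t| ≤ 1 := by
      have := mul_nonneg hτ0.le ht.1
      have h2 : τ * t ≤ 1 := by nlinarith [ht.2, ht.1, hτS.1.2]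
      rw [abs_le]; constructor <;> linarith
    nlinarith [norm_nonneg (c - z)]
  · intro P hP hcl
    have hPb := cayInv_mem hζ hP
    have hcont : ContinuousAt (fun v => φ (cayInv ζ v)) P :=
      ContinuousAt.comp (f := cayInv ζ) (g := φ) (hφcont.continuousAt (isOpen_ball.mem_nhds hPb))
        (cayInv_diff (by linarith)).continuousAt
    have h1 := hcl.continuousAt_comp hcont
    have h2 : Tendsto ((fun v => φ (cayInv ζ v)) ∘ fun t => cay ζ (ψ (seg (τ * t) : ℂ∞))) (𝓝[<] 1)
        (𝓝 (seg τ : ℂ∞)) := by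
      have h3 : Tendsto (fun t : ℝ => (seg (τ * t) : ℂ∞)) (𝓝[<] 1) (𝓝 (seg τ : ℂ∞)) := by
        have hm : Continuous (fun t : ℝ => τ * t) := by fun_prop
        have h6 : Tendsto (fun t : ℝ => (seg (τ * t) : ℂ∞)) (𝓝 1) (𝓝 (seg (τ * 1) : ℂ∞)) :=
          (cseg.comp hm).tendsto 1
        rw [mul_one] at h6
        exact h6.mono_left nhdsWithin_le_nhds
      refine h3.congr' ?_
      filter_upwards [Ioo_mem_nhdsLT (zero_lt_one' ℝ)] with t ht
      exact (hback t ⟨ht.1.le, ht.2⟩).symm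
    have h4 : φ (cayInv ζ P) = seg τ := by
      by_contra hne
      have hd := disjoint_nhds_nhds.2 hne
      have h5 : (𝓝 (φ (cayInv ζ P)) ⊓ 𝓝 (seg τ : ℂ∞)).NeBot := by
        have : ClusterPt (φ (cayInv ζ P)) _ := h1
        exact NeBot.mono this (inf_le_inf_left _ h2)
      exact h5.ne hd.eq_bot
    have h7 := hφmaps hPb
    rw [h4] at h7
    exact hτS.2 h7

lemma main_aux {U : Set ℂ∞} (hU : IsOpen U) (hinfty : ∞ ∈ U)
    {φ : ℂ → ℂ∞} {ψ : ℂ∞ → ℂ}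
    (hφcont : ContinuousOn φ (ball (0 : ℂ) 1))
    (hφmaps : MapsTo φ (ball (0 : ℂ) 1) U)
    (hφhol : HolomorphicIntoSphereOn φ (ball (0 : ℂ) 1))
    (hψcont : ContinuousOn ψ U)
    (hψmaps : MapsTo ψ U (ball (0 : ℂ) 1))
    (hψφ : ∀ z ∈ ball (0 : ℂ) 1, ψ (φ z) = z)
    (hφψ : ∀ w ∈ U, φ (ψ w) = w)
    {ζ : ℂ} (hζ : ‖ζ‖ = 1) {σ : ℝ} (hσ : σ = 1 ∨ σ = -1) {z w : ℂ∞}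
    {α β : ℕ → ℂ∞} (hα : ∀ j, α j ∈ U ∧ 0 ≤ σ * (ψ (α j) / ζ).im)
    (hβ : ∀ j, β j ∈ U ∧ 0 ≤ σ * (ψ (β j) / ζ).im)
    (hα0 : Tendsto (fun j => ψ (α j)) atTop (𝓝 ζ)) (hβ0 : Tendsto (fun j => ψ (β j)) atTop (𝓝 ζ))
    (hαz : Tendsto α atTop (𝓝 z)) (hβw : Tendsto β atTop (𝓝 w))
    (hz : StronglyMinimal U ψ ζ z) (hw : StronglyMinimal U ψ ζ w) : z = w := by
  by_contra hzw
  have hzU := not_mem_U hU hψcont hψmaps hζ hα0 hαz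
  have hwU := not_mem_U hU hψcont hψmaps hζ hβ0 hβw
  obtain ⟨z, rfl⟩ := OnePoint.ne_infty_iff_exists.1 (fun h => hzU (h ▸ hinfty) : z ≠ ∞)
  obtain ⟨w, rfl⟩ := OnePoint.ne_infty_iff_exists.1 (fun h => hwU (h ▸ hinfty) : w ≠ ∞)
  obtain ⟨Γp, ⟨⟨cp, mp⟩, hp0⟩, hpα, hpw⟩ := hw α (fun j => (hα j).1) hα0 (by
    rintro ⟨n, hn, ht⟩
    exact hzw (tendsto_nhds_unique (hαz.comp hn.tendsto_atTop) ht))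
  obtain ⟨Γq, ⟨⟨cq, mq⟩, hq0⟩, hqβ, hqz⟩ := hz β (fun j => (hβ j).1) hβ0 (by
    rintro ⟨n, hn, ht⟩
    exact hzw (tendsto_nhds_unique ht (hβw.comp hn.tendsto_atTop)))
  obtain ⟨R, ρ, hρ, hbd⟩ := bdd_near hU hinfty hψcont hψmaps hψφ hζ
  have hfin : ∀ v ∈ HB 0 ρ, φ (cayInv ζ v) ≠ ∞ := fun v hv => (hbd v hv).1
  have hn : ∀ {x : ℂ∞}, x ∈ U → ‖ψ x‖ < 1 := fun hx => by simpa using hψmaps hx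
  have hF : ∀ {x : ℂ∞}, x ∈ U → toC (φ (cayInv ζ (cay ζ (ψ x)))) = toC x := fun hx => by
    rw [cayInv_cay hζ (hn hx), hφψ _ hx]
  have htl : ∀ {Γ : ℝ → ℂ∞}, MapsTo Γ (Ici 0) U → Tendsto (fun t => ψ (Γ t)) atTop (𝓝 ζ) →
      ∀ {y : ℂ}, (y : ℂ∞) ∉ accSet Γ →
      ∃ δ > 0, ∀ᶠ t in atTop, δ ≤ dist (toC (φ (cayInv ζ (cay ζ (ψ (Γ t)))))) y := by
    intro Γ hm h0 y hy
    obtain ⟨δ, hδ, h⟩ := tail_avoid hy (by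
      filter_upwards [((cay_tend hζ).comp h0).eventually (ball_mem_nhds 0 hρ),
        eventually_ge_atTop 0] with t ht ht0
      have hU' := hm ht0
      have := hfin (cay ζ (ψ (Γ t))) ⟨cay_im hζ (hn hU'), by simpa using ht⟩
      rwa [cayInv_cay hζ (hn hU'), hφψ _ hU'] at this)
    refine ⟨δ, hδ, ?_⟩
    filter_upwards [h, eventually_ge_atTop 0] with t ht ht0
    rwa [hF (hm ht0)]
  have hcurve : ∀ {Γ : ℝ → ℂ∞}, ContinuousOn Γ (Ici 0) → MapsTo Γ (Ici 0) U →
      ContinuousOn (fun t => cay ζ (ψ (Γ t))) (Ici 0) := fun hc hm =>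
    (cay_cont hζ).comp (hψcont.comp hc hm) (fun t ht => hψmaps (hm ht))
  refine core (f := fun v => toC (φ (cayInv ζ v))) (ρ := ρ) (z := z) (w := w) (σ := σ)
    (a := fun j => cay ζ (ψ (α j))) (b := fun j => cay ζ (ψ (β j)))
    (p := fun t => cay ζ (ψ (Γp t))) (q := fun t => cay ζ (ψ (Γq t))) hρ ?_ ?_ ?_
    (fun h => hzw (by rw [h])) hσ ((cay_tend hζ).comp hα0) ((cay_tend hζ).comp hβ0) ?_ ?_ ?_ ?_
    (hcurve cp mp) (fun t ht => cay_im hζ (hn (mp ht))) ((cay_tend hζ).comp hp0) ?_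
    (hcurve cq mq) (fun t ht => cay_im hζ (hn (mq ht))) ((cay_tend hζ).comp hq0) ?_
    (htl mp hp0 hpw) (htl mq hq0 hqz)
    (reach_of hU hφcont hφmaps hψcont hψmaps hψφ hφψ hζ hfin hzU)
    (reach_of hU hφcont hφmaps hψcont hψmaps hψφ hφψ hζ hfin hwU)
  · intro v hv
    have h1 := toC_diff hφhol (cayInv_mem hζ hv.1) (hfin v hv)
    have h2 : DifferentiableAt ℂ (cayInv ζ) v := cayInv_diff (by have := hv.1; simp only [mem_ofPred_eq] at this; linarith)
    exact (DifferentiableAt.comp v h1 h2).differentiableWithinAt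
  · intro v hv v' hv' he
    have he' : toC (φ (cayInv ζ v)) = toC (φ (cayInv ζ v')) := he
    have h1 : φ (cayInv ζ v) = φ (cayInv ζ v') := by
      rw [← coe_toC (hfin v hv), ← coe_toC (hfin v' hv'), he']
    have h2 := congrArg ψ h1
    rw [hψφ _ (cayInv_mem hζ hv.1), hψφ _ (cayInv_mem hζ hv'.1)] at h2
    have h3 := congrArg (cay ζ) h2
    rwa [cay_cayInv hζ hv.1, cay_cayInv hζ hv'.1] at h3
  · refine ne_top_of_le_ne_top (MeasureTheory.measure_closedBall_lt_top (μ := MeasureTheory.volume) (x := (0:ℂ)) (r := R)).ne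
      (MeasureTheory.measure_mono ?_)
    rintro _ ⟨v, hv, rfl⟩
    simpa using (hbd v hv).2
  · exact fun j => ⟨cay_im hζ (hn (hα j).1), cay_re (hα j).2⟩
  · refine (toC_tend hαz).congr (fun j => (hF (hα j).1).symm)
  · exact fun j => ⟨cay_im hζ (hn (hβ j).1), cay_re (hβ j).2⟩
  · refine (toC_tend hβw).congr (fun j => (hF (hβ j).1).symm)
  · intro j
    obtain ⟨t, ht, e⟩ := hpα j
    exact ⟨t, ht, by rw [e]⟩
  · intro j
    obtain ⟨t, ht, e⟩ := hqβ j
    exact ⟨t, ht, by rw [e]⟩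

lemma wing_seq {U : Set ℂ∞} {ψ : ℂ∞ → ℂ} {ζ : ℂ} {z : ℂ∞} {σ : ℝ} {Γ : ℝ → ℂ∞}
    (h : ConvergesToPrimeEnd U ψ Γ ζ) (hs : ∀ᶠ t in atTop, 0 ≤ σ * (ψ (Γ t) / ζ).im)
    (hz : z ∈ accSet Γ) : ∃ α : ℕ → ℂ∞, (∀ j, α j ∈ U ∧ 0 ≤ σ * (ψ (α j) / ζ).im) ∧
      Tendsto (fun j => ψ (α j)) atTop (𝓝 ζ) ∧ Tendsto α atTop (𝓝 z) := by
  obtain ⟨t, ht, htz⟩ := hz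
  obtain ⟨N, hN⟩ := eventually_atTop.1 (ht.eventually (hs.and (eventually_ge_atTop 0)))
  have hsh : Tendsto (fun j => j + N) atTop atTop := tendsto_add_atTop_nat N
  exact ⟨fun j => Γ (t (j + N)), fun j => ⟨h.1.2 (hN _ (by omega)).2, (hN _ (by omega)).1⟩,
    h.2.comp (ht.comp hsh), htz.comp hsh⟩

/-- Each wing of a prime end contains at most one strongly minimal point. -/
theorem stmt8
    (U : Set ℂ∞) (hUopen : IsOpen U) (hUconn : IsConnected U)
    (hUsc : SimplyConnectedSpace U) (hinfty : ∞ ∈ U)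
    (hKconn : IsConnected Uᶜ) (hKnt : Set.Nontrivial Uᶜ)
    (φ : ℂ → ℂ∞) (ψ : ℂ∞ → ℂ)
    (hφcont : ContinuousOn φ (ball (0 : ℂ) 1))
    (hφmaps : MapsTo φ (ball (0 : ℂ) 1) U)
    (hφhol : HolomorphicIntoSphereOn φ (ball (0 : ℂ) 1))
    (hψcont : ContinuousOn ψ U)
    (hψmaps : MapsTo ψ U (ball (0 : ℂ) 1))
    (hψφ : ∀ z ∈ ball (0 : ℂ) 1, ψ (φ z) = z)
    (hφψ : ∀ w ∈ U, φ (ψ w) = w)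
    (ζ : ℂ) (hζ : ζ ∈ sphere (0 : ℂ) 1) :
    (∀ z w : ℂ∞, z ∈ leftWing U ψ ζ → w ∈ leftWing U ψ ζ →
      StronglyMinimal U ψ ζ z → StronglyMinimal U ψ ζ w → z = w) ∧
    (∀ z w : ℂ∞, z ∈ rightWing U ψ ζ → w ∈ rightWing U ψ ζ →
      StronglyMinimal U ψ ζ z → StronglyMinimal U ψ ζ w → z = w) := by
  have hζ' : ‖ζ‖ = 1 := by simpa using hζ
  constructor
  · rintro z w ⟨Γ, ⟨h1, h2⟩, h3⟩ ⟨Δ, ⟨k1, k2⟩, k3⟩ hz hw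
    obtain ⟨α, a1, a2, a3⟩ := wing_seq (σ := 1) h1 (by simpa using h2) h3
    obtain ⟨β, b1, b2, b3⟩ := wing_seq (σ := 1) k1 (by simpa using k2) k3
    exact main_aux hUopen hinfty hφcont hφmaps hφhol hψcont hψmaps hψφ hφψ hζ' (Or.inl rfl)
      a1 b1 a2 b2 a3 b3 hz hw
  · rintro z w ⟨Γ, ⟨h1, h2⟩, h3⟩ ⟨Δ, ⟨k1, k2⟩, k3⟩ hz hw
    obtain ⟨α, a1, a2, a3⟩ := wing_seq (σ := -1) h1 (by simpa using h2) h3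
    obtain ⟨β, b1, b2, b3⟩ := wing_seq (σ := -1) k1 (by simpa using k2) k3
    exact main_aux hUopen hinfty hφcont hφmaps hφhol hψcont hψmaps hψφ hφψ hζ' (Or.inr rfl)
      a1 b1 a2 b2 a3 b3 hz hw

end
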